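/- arXiv:1304.5147 — 2 statements merged into one kernel-verified Lean document; each statement's English description precedes it below -/
import Mathlib

section
/- Let N ≥ 3, T > 0, and ξ : [0,T] → ℝ^N be Hölder continuous with exponent 1/2. Suppose u is a classical solution of the heat equation u_t = Δu on D = {(x,t) : x ∈ Ω \ {ξ(t)}, t ∈ (0,T)}, where Ω ⊂ ℝ^N is a domain containing ξ(t) for all t. If for all 0 < t₁ < t₂ < T and every ε ∈ (0,1) there exists r ∈ (0,1) such that |u(x,t)| ≤ ε |x-ξ(t)|^{2-N} whenever 0 < |x-ξ(t)| < r and t ∈ [t₁,t₂], then there exists a classical solution ũ of the heat equation on Ω × (0,T) with ũ = u on D. -/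
open MeasureTheory Real Set Metric

noncomputable section

/-- `u` is a classical solution of the heat equation `u_t = Δu` on the set `S`:
`u` is continuous on `S`, C² in the space variable at each point of `S`, differentiable in
time, and the time derivative equals the spatial Laplacian (sum of second partials). -/
def IsHeatSolution {N : ℕ} (u : EuclideanSpace ℝ (Fin N) → ℝ → ℝ)
    (S : Set (EuclideanSpace ℝ (Fin N) × ℝ)) : Prop :=
  ContinuousOn (fun p => u p.1 p.2) S ∧
  ∀ p ∈ S, ContDiffAt ℝ 2 (fun x => u x p.2) p.1 ∧
    HasDerivAt (fun τ => u p.1 τ)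
      (∑ i, iteratedDeriv 2
        (fun h : ℝ => u (p.1 + h • EuclideanSpace.single i (1 : ℝ)) p.2) 0) p.2

section Helpers

open Filter Topology

variable {N : ℕ}

local notation "𝔼" => EuclideanSpace ℝ (Fin N)
local notation "𝐞" i => EuclideanSpace.single (i : Fin N) (1 : ℝ)

/-- The second derivative is nonpositive at a local maximum. -/
lemma iteratedDeriv_two_nonpos_of_isLocalMax {f : ℝ → ℝ} (hf : ContDiffAt ℝ 2 f 0)
    (hmax : IsLocalMax f 0) : iteratedDeriv 2 f 0 ≤ 0 := by
  by_contra! hpos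
  have h2 : iteratedDeriv 2 f 0 = deriv (deriv f) 0 := by
    rw [iteratedDeriv_succ, iteratedDeriv_one]
  have hmin : IsLocalMin f 0 :=
    isLocalMin_of_deriv_deriv_pos (h2 ▸ hpos) hmax.deriv_eq_zero hf.continuousAt
  have hconst : f =ᶠ[𝓝 0] fun _ => f 0 := by
    filter_upwards [hmax, hmin] with x h1 h2
    exact le_antisymm h1 h2
  have := hconst.iteratedDeriv_eq 2
  rw [this] at hpos
  simp [iteratedDeriv_const] at hpos

lemma contDiffAt_line {g : 𝔼 → ℝ} {x : 𝔼} (hg : ContDiffAt ℝ 2 g x) (v : 𝔼) :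
    ContDiffAt ℝ 2 (fun h : ℝ => g (x + h • v)) 0 := by
  have : ContDiffAt ℝ 2 g (x + (0 : ℝ) • v) := by simpa using hg
  exact this.comp (0 : ℝ) (by fun_prop)

/-- A pointwise weak maximum principle on a compact set. -/
lemma nonpos_of_strict_subsolution {K : Set (𝔼 × ℝ)} (hK : IsCompact K) {g : 𝔼 → ℝ → ℝ}
    (hg : ContinuousOn (fun p : 𝔼 × ℝ => g p.1 p.2) K)
    (hint : ∀ p ∈ K, 0 < g p.1 p.2 →
      (∀ᶠ x in 𝓝 p.1, (x, p.2) ∈ K) ∧ (∀ᶠ s in 𝓝[<] p.2, (p.1, s) ∈ K) ∧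
      ContDiffAt ℝ 2 (fun x => g x p.2) p.1 ∧
      ∃ d, HasDerivAt (fun s => g p.1 s) d p.2 ∧
        d < ∑ i, iteratedDeriv 2 (fun h : ℝ => g (p.1 + h • 𝐞 i) p.2) 0) :
    ∀ p ∈ K, g p.1 p.2 ≤ 0 := by
  intro q hq
  by_contra! hqpos
  obtain ⟨p, hpK, hp⟩ := hK.exists_isMaxOn ⟨q, hq⟩ hg
  have hppos : 0 < g p.1 p.2 := hqpos.trans_le (hp hq)
  obtain ⟨hx, hs, hC, d, hd, hlt⟩ := hint p hpK hppos
  have h1 : ∑ i, iteratedDeriv 2 (fun h : ℝ => g (p.1 + h • 𝐞 i) p.2) 0 ≤ 0 := by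
    refine Finset.sum_nonpos fun i _ => ?_
    refine iteratedDeriv_two_nonpos_of_isLocalMax (contDiffAt_line hC _) ?_
    have ht : Tendsto (fun h : ℝ => p.1 + h • 𝐞 i) (𝓝 0) (𝓝 p.1) := by
      have : Continuous (fun h : ℝ => p.1 + h • 𝐞 i) := by fun_prop
      simpa using this.tendsto 0
    filter_upwards [ht.eventually hx] with h hh
    simpa using hp hh
  have h2 : 0 ≤ d := by
    have hd' := (hasDerivAt_iff_tendsto_slope_left_right.mp hd).1
    refine ge_of_tendsto hd' ?_
    filter_upwards [hs, self_mem_nhdsWithin] with s hsK hslt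
    rw [slope_def_field]
    have h3 : g p.1 s ≤ g p.1 p.2 := hp hsK
    exact div_nonneg_of_nonpos (by linarith) (by simpa using (le_of_lt hslt))
  linarith

lemma IsHeatSolution.mono {u : 𝔼 → ℝ → ℝ} {S S' : Set (𝔼 × ℝ)} (hu : IsHeatSolution u S)
    (h : S' ⊆ S) : IsHeatSolution u S' :=
  ⟨hu.1.mono h, fun p hp => hu.2 p (h hp)⟩

lemma IsHeatSolution.comp_add_right {u : 𝔼 → ℝ → ℝ} {S S' : Set (𝔼 × ℝ)}
    (hu : IsHeatSolution u S) (a : 𝔼) (h : ∀ p ∈ S', (p.1 + a, p.2) ∈ S) :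
    IsHeatSolution (fun x t => u (x + a) t) S' := by
  refine ⟨hu.1.comp (f := fun p : 𝔼 × ℝ => (p.1 + a, p.2)) (by fun_prop) h, fun p hp => ?_⟩
  obtain ⟨h1, h2⟩ := hu.2 _ (h p hp)
  refine ⟨ContDiffAt.comp (g := fun x => u x p.2) p.1 h1 (by fun_prop), h2.congr_deriv ?_⟩
  simp only [add_right_comm]

lemma IsHeatSolution.sub {u v : 𝔼 → ℝ → ℝ} {S : Set (𝔼 × ℝ)}
    (hu : IsHeatSolution u S) (hv : IsHeatSolution v S) :
    IsHeatSolution (fun x t => u x t - v x t) S := by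
  refine ⟨hu.1.sub hv.1, fun p hp => ?_⟩
  obtain ⟨ha1, ha2⟩ := hu.2 _ hp
  obtain ⟨hb1, hb2⟩ := hv.2 _ hp
  refine ⟨ha1.sub hb1, (ha2.sub hb2).congr_deriv ?_⟩
  rw [← Finset.sum_sub_distrib]
  exact Finset.sum_congr rfl fun i _ =>
    (iteratedDeriv_sub (n := 2) (contDiffAt_line ha1 (𝐞 i)) (contDiffAt_line hb1 (𝐞 i))).symm

lemma IsHeatSolution.neg {u : 𝔼 → ℝ → ℝ} {S : Set (𝔼 × ℝ)} (hu : IsHeatSolution u S) :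
    IsHeatSolution (fun x t => - u x t) S := by
  refine ⟨hu.1.neg, fun p hp => ⟨(hu.2 p hp).1.neg, ?_⟩⟩
  refine (hu.2 p hp).2.neg.congr_deriv ?_
  rw [← Finset.sum_neg_distrib]
  exact Finset.sum_congr rfl fun i _ => (iteratedDeriv_fun_neg _ _ _).symm

lemma IsHeatSolution.congr {u v : 𝔼 → ℝ → ℝ} {S : Set (𝔼 × ℝ)} (hu : IsHeatSolution u S)
    (hS : IsOpen S) (h : ∀ p ∈ S, v p.1 p.2 = u p.1 p.2) : IsHeatSolution v S := by
  refine ⟨hu.1.congr h, fun p hp => ?_⟩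
  have hx : (fun x => v x p.2) =ᶠ[𝓝 p.1] fun x => u x p.2 := by
    have ht : Tendsto (fun x : 𝔼 => (x, p.2)) (𝓝 p.1) (𝓝 p) :=
      Continuous.tendsto (by fun_prop : Continuous fun x : 𝔼 => (x, p.2)) p.1
    filter_upwards [ht.eventually (hS.mem_nhds hp)] with x hx using h _ hx
  have hs : (fun s => v p.1 s) =ᶠ[𝓝 p.2] fun s => u p.1 s := by
    have ht : Tendsto (fun s : ℝ => (p.1, s)) (𝓝 p.2) (𝓝 p) :=
      Continuous.tendsto (by fun_prop : Continuous fun s : ℝ => (p.1, s)) p.2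
    filter_upwards [ht.eventually (hS.mem_nhds hp)] with s hs using h _ hs
  refine ⟨(hu.2 p hp).1.congr_of_eventuallyEq hx, ?_⟩
  refine ((hu.2 p hp).2.congr_of_eventuallyEq hs).congr_deriv ?_
  refine Finset.sum_congr rfl fun i _ => Filter.EventuallyEq.iteratedDeriv_eq 2 ?_
  have ht : Tendsto (fun h : ℝ => p.1 + h • 𝐞 i) (𝓝 0) (𝓝 p.1) := by
    have : Continuous (fun h : ℝ => p.1 + h • 𝐞 i) := by fun_prop
    simpa using this.tendsto 0
  exact (ht.eventually hx).mono fun h hh => hh.symm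

/-- Reflection across the hyperplane through `x₀` orthogonal to the `i`-th coordinate axis. -/
def coordReflection (x₀ : 𝔼) (i : Fin N) (x : 𝔼) : 𝔼 := x - (2 * (x i - x₀ i)) • 𝐞 i

lemma norm_coordReflection_sub (x₀ : 𝔼) (i : Fin N) (x : 𝔼) :
    ‖coordReflection x₀ i x - x₀‖ = ‖x - x₀‖ := by
  rw [EuclideanSpace.norm_eq, EuclideanSpace.norm_eq]
  congr 1
  refine Finset.sum_congr rfl fun j _ => ?_
  by_cases hj : j = i
  · subst hj
    simp only [coordReflection, PiLp.sub_apply, PiLp.smul_apply, PiLp.single_apply,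
      if_true, smul_eq_mul, mul_one, norm_eq_abs, sq_abs]
    ring
  · simp [coordReflection, hj]

lemma coordReflection_add_smul_self (x₀ : 𝔼) (i : Fin N) (x : 𝔼) (h : ℝ) :
    coordReflection x₀ i (x + h • 𝐞 i) = coordReflection x₀ i x + (-h) • 𝐞 i := by
  simp only [coordReflection, PiLp.add_apply, PiLp.smul_apply, PiLp.single_apply,
    if_true, smul_eq_mul, mul_one]
  module

lemma coordReflection_add_smul_of_ne (x₀ : 𝔼) {i j : Fin N} (hij : i ≠ j) (x : 𝔼) (h : ℝ) :
    coordReflection x₀ i (x + h • 𝐞 j) = coordReflection x₀ i x + h • 𝐞 j := by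
  simp only [coordReflection, PiLp.add_apply, PiLp.smul_apply, PiLp.single_apply,
    if_neg hij, smul_eq_mul, mul_zero, add_zero]
  module

lemma contDiff_coordReflection (x₀ : 𝔼) (i : Fin N) : ContDiff ℝ 2 (coordReflection x₀ i) := by
  unfold coordReflection
  have : ContDiff ℝ 2 (fun x : 𝔼 => x i) := by fun_prop
  fun_prop

lemma IsHeatSolution.comp_coordReflection {u : 𝔼 → ℝ → ℝ} {S S' : Set (𝔼 × ℝ)}
    (hu : IsHeatSolution u S) (x₀ : 𝔼) (i : Fin N)
    (h : ∀ p ∈ S', (coordReflection x₀ i p.1, p.2) ∈ S) :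
    IsHeatSolution (fun x t => u (coordReflection x₀ i x) t) S' := by
  have hσ := contDiff_coordReflection x₀ i
  have hσc := hσ.continuous
  refine ⟨hu.1.comp (f := fun p : 𝔼 × ℝ => (coordReflection x₀ i p.1, p.2)) (by fun_prop) h,
    fun p hp => ?_⟩
  obtain ⟨h1, h2⟩ := hu.2 _ (h p hp)
  refine ⟨ContDiffAt.comp (g := fun x => u x p.2) p.1 h1 hσ.contDiffAt, h2.congr_deriv ?_⟩
  refine Finset.sum_congr rfl fun j _ => ?_
  by_cases hij : i = j
  · subst hij
    simp only [coordReflection_add_smul_self]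
    rw [iteratedDeriv_comp_neg 2 (fun h : ℝ => u (coordReflection x₀ i p.1 + h • 𝐞 i) p.2)]
    simp
  · simp only [coordReflection_add_smul_of_ne x₀ hij]

lemma iteratedDeriv_two_quadratic (a b c : ℝ) :
    iteratedDeriv 2 (fun h : ℝ => a + b * h + c * h ^ 2) 0 = 2 * c := by
  rw [iteratedDeriv_succ, iteratedDeriv_one]
  have h1 : deriv (fun h : ℝ => a + b * h + c * h ^ 2) = fun h => b + 2 * c * h := by
    funext h
    have := ((hasDerivAt_id h).const_mul b).const_add a |>.add
      (((hasDerivAt_id h).pow 2).const_mul c)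
    refine (this.congr_deriv ?_).deriv
    simp; ring
  rw [h1]
  have := ((hasDerivAt_id (0 : ℝ)).const_mul (2 * c)).const_add b
  refine (this.congr_deriv ?_).deriv
  simp

lemma norm_add_smul_single_sub_sq (x x₀ : 𝔼) (j : Fin N) (h : ℝ) :
    ‖x + h • (𝐞 j) - x₀‖ ^ 2 = ‖x - x₀‖ ^ 2 + 2 * (x j - x₀ j) * h + h ^ 2 := by
  have : x + h • (𝐞 j) - x₀ = (x - x₀) + h • 𝐞 j := by abel
  rw [this, norm_add_sq_real, inner_smul_right, norm_smul]
  simp [EuclideanSpace.inner_single_right]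
  ring

/-- One-sided interior Lipschitz estimate obtained by comparison with a quadratic barrier. -/
lemma IsHeatSolution.sub_le_of_abs_le {w : 𝔼 → ℝ → ℝ} {x₀ : 𝔼} {t₀ R M : ℝ} (hR : 0 < R)
    (hM : 0 < M) (hw : IsHeatSolution w (closedBall x₀ R ×ˢ Icc (t₀ - R ^ 2) t₀))
    (hb : ∀ p ∈ closedBall x₀ R ×ˢ Icc (t₀ - R ^ 2) t₀, |w p.1 p.2| ≤ M) (i : Fin N)
    {h : ℝ} (h0 : 0 ≤ h) (hhR : h ≤ R) :
    w (x₀ + h • 𝐞 i) t₀ - w (x₀ + (-h) • 𝐞 i) t₀ ≤ (4 * N + 6) / R * M * h := by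
  set A : ℝ := 2 * M / R ^ 2 with hA
  have hApos : 0 < A := by positivity
  have hAR : A * R ^ 2 = 2 * M := by rw [hA]; field_simp
  set κ : ℝ := A * (N + 1) with hκ
  have hκpos : 0 < κ := by positivity
  set Q := closedBall x₀ R ×ˢ Icc (t₀ - R ^ 2) t₀ with hQ
  set K : Set (𝔼 × ℝ) := Q ∩ {p | x₀ i ≤ p.1 i} with hK
  have hKc : IsCompact K := by
    refine ((isCompact_closedBall x₀ R).prod isCompact_Icc).inter_right ?_
    exact isClosed_le continuous_const (by fun_prop)
  have hφ : IsHeatSolution (fun x t => w x t - w (coordReflection x₀ i x) t) Q := by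
    refine hw.sub (hw.comp_coordReflection x₀ i ?_)
    rintro p ⟨hp1, hp2⟩
    refine ⟨?_, hp2⟩
    rw [mem_closedBall, dist_eq_norm] at hp1 ⊢
    rwa [norm_coordReflection_sub]
  have hφb : ∀ p ∈ Q, w p.1 p.2 - w (coordReflection x₀ i p.1) p.2 ≤ 2 * M := by
    rintro p ⟨hp1, hp2⟩
    have h1 := hb p ⟨hp1, hp2⟩
    have h2 := hb (coordReflection x₀ i p.1, p.2) ⟨by
      rw [mem_closedBall, dist_eq_norm] at hp1 ⊢
      rwa [norm_coordReflection_sub], hp2⟩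
    have := abs_le.mp h1
    have := abs_le.mp h2
    dsimp only at *
    linarith
  set ψ : 𝔼 → ℝ → ℝ := fun x t => A * (‖x - x₀‖ ^ 2 + (t₀ - t)) +
    κ * ((x i - x₀ i) * (2 * R - (x i - x₀ i))) with hψ
  have hcoord : ∀ p ∈ Q, |p.1 i - x₀ i| ≤ R := by
    rintro p ⟨hp1, -⟩
    rw [mem_closedBall, dist_eq_norm] at hp1
    exact (PiLp.norm_apply_le (p.1 - x₀) i).trans hp1
  have key := nonpos_of_strict_subsolution hKc
    (g := fun x t => (w x t - w (coordReflection x₀ i x) t) - ψ x t) ?_ ?_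
  · have hmem : (x₀ + h • (𝐞 i), t₀) ∈ K := by
      refine ⟨⟨?_, ?_⟩, ?_⟩
      · rw [mem_closedBall, dist_eq_norm]
        simp [norm_smul, abs_of_nonneg h0, hhR]
      · exact ⟨by nlinarith, le_rfl⟩
      · simp [h0]
    have h1 := key _ hmem
    have h2 : coordReflection x₀ i (x₀ + h • 𝐞 i) = x₀ + (-h) • 𝐞 i := by
      rw [coordReflection_add_smul_self]; simp [coordReflection]
    simp only [h2, hψ] at h1
    have h3 : ‖x₀ + h • (𝐞 i) - x₀‖ ^ 2 = h ^ 2 := by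
      rw [norm_add_smul_single_sub_sq]; simp
    have h4 : (x₀ + h • 𝐞 i) i - x₀ i = h := by simp
    rw [h3, h4] at h1
    have h5 : (4 * N + 6) / R * M * h = (A * R) * (2 * N + 3) * h := by
      rw [hA]; field_simp; ring
    rw [h5]
    have h6 : A * h ^ 2 ≤ A * R * h := by
      have := mul_le_mul_of_nonneg_left hhR (by positivity : 0 ≤ A * h)
      nlinarith
    have h7 : κ * (h * (2 * R - h)) ≤ κ * (h * (2 * R)) := by
      gcongr; linarith
    have h8 : κ * (h * (2 * R)) = A * R * (2 * N + 2) * h := by rw [hκ]; ring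
    linarith
  · refine (hφ.1.mono inter_subset_left).sub (Continuous.continuousOn ?_)
    simp only [hψ]; fun_prop
  · rintro ⟨x, t⟩ ⟨hpQ, hpi⟩ hpos
    obtain ⟨hp1, hp2⟩ := hpQ
    simp only [mem_ofPred_eq] at hpi
    dsimp only at hp1 hp2 hpos ⊢
    have hc := hcoord (x, t) ⟨hp1, hp2⟩
    dsimp only at hc
    have hb' := hφb (x, t) ⟨hp1, hp2⟩
    dsimp only at hb'
    have hy0 : 0 ≤ x i - x₀ i := by linarith
    have hyR : x i - x₀ i ≤ R := (le_abs_self _).trans hc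
    have hyy : 0 ≤ κ * ((x i - x₀ i) * (2 * R - (x i - x₀ i))) := by
      have : 0 ≤ 2 * R - (x i - x₀ i) := by linarith
      positivity
    have hx : ‖x - x₀‖ < R := by
      by_contra! hge
      have : R ^ 2 ≤ ‖x - x₀‖ ^ 2 := by gcongr
      have h2 : A * R ^ 2 ≤ A * (‖x - x₀‖ ^ 2 + (t₀ - t)) := by
        gcongr; linarith [hp2.2]
      simp only [hψ] at hpos
      linarith
    have ht : t₀ - R ^ 2 < t := by
      by_contra! hge
      have h2 : A * R ^ 2 ≤ A * (‖x - x₀‖ ^ 2 + (t₀ - t)) := by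
        gcongr; nlinarith [sq_nonneg ‖x - x₀‖]
      simp only [hψ] at hpos
      linarith
    have hy : x₀ i < x i := by
      refine lt_of_le_of_ne hpi fun heq => ?_
      have h1 : coordReflection x₀ i x = x := by simp [coordReflection, heq]
      have h2 : 0 ≤ A * (‖x - x₀‖ ^ 2 + (t₀ - t)) := by
        have : 0 ≤ t₀ - t := by linarith [hp2.2]
        positivity
      simp only [hψ, h1] at hpos
      linarith
    have hbase := hφ.2 (x, t) ⟨hp1, hp2⟩
    dsimp only at hbase
    have hψC : ContDiffAt ℝ 2 (fun x => ψ x t) x := by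
      simp only [hψ]
      have h1 : ContDiff ℝ 2 (fun x : 𝔼 => ‖x - x₀‖ ^ 2) :=
        (contDiff_id.sub contDiff_const).norm_sq ℝ
      have h2 : ContDiff ℝ 2 (fun x : 𝔼 => x i) := by fun_prop
      exact ContDiff.contDiffAt (by fun_prop)
    refine ⟨?_, ?_, hbase.1.sub hψC, _, hbase.2.sub (?_ : HasDerivAt (fun s => ψ x s) (-A) t), ?_⟩
    · have h1 : ∀ᶠ y in 𝓝 x, y ∈ ball x₀ R := isOpen_ball.mem_nhds (by simpa [dist_eq_norm] using hx)
      have h2 : ∀ᶠ y : 𝔼 in 𝓝 x, x₀ i < y i :=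
        (isOpen_lt continuous_const (by fun_prop)).mem_nhds hy
      filter_upwards [h1, h2] with y hy1 hy2
      exact ⟨⟨ball_subset_closedBall hy1, hp2⟩, hy2.le⟩
    · filter_upwards [Ioo_mem_nhdsLT ht] with s hs
      exact ⟨⟨hp1, hs.1.le, hs.2.le.trans hp2.2⟩, hpi⟩
    · have := ((((hasDerivAt_id t).const_sub t₀).const_add (‖x - x₀‖ ^ 2)).const_mul A).add_const
        (κ * ((x i - x₀ i) * (2 * R - (x i - x₀ i))))
      exact this.congr_deriv (by simp)
    · have hsum : ∀ j : Fin N, iteratedDeriv 2 (fun h : ℝ =>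
          (w (x + h • 𝐞 j) t - w (coordReflection x₀ i (x + h • 𝐞 j)) t) - ψ (x + h • 𝐞 j) t) 0
          = iteratedDeriv 2 (fun h : ℝ =>
          w (x + h • 𝐞 j) t - w (coordReflection x₀ i (x + h • 𝐞 j)) t) 0
          - (2 * A - if i = j then 2 * κ else 0) := by
        intro j
        refine (iteratedDeriv_sub (n := 2) (contDiffAt_line hbase.1 (𝐞 j))
          (contDiffAt_line hψC (𝐞 j))).trans ?_
        congr 1
        have : (fun h : ℝ => ψ (x + h • 𝐞 j) t) = fun h : ℝ => ψ x t +
            (if i = j then A * (2 * (x j - x₀ j)) + κ * (2 * R - 2 * (x i - x₀ i))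
              else A * (2 * (x j - x₀ j))) * h + (A - if i = j then κ else 0) * h ^ 2 := by
          funext h
          simp only [hψ, norm_add_smul_single_sub_sq]
          by_cases hij : i = j
          · subst hij
            simp
            ring
          · simp [hij]
            ring
        rw [this, iteratedDeriv_two_quadratic]
        split_ifs <;> ring
      simp only [hsum]
      rw [Finset.sum_sub_distrib, Finset.sum_sub_distrib]
      simp only [Finset.sum_const, Finset.card_univ, Fintype.card_fin, nsmul_eq_mul,
        Finset.sum_ite_eq, Finset.mem_univ, if_true]
      rw [hκ]
      nlinarith

lemma IsHeatSolution.abs_sub_le_of_abs_le {w : 𝔼 → ℝ → ℝ} {x₀ : 𝔼} {t₀ R M : ℝ} (hR : 0 < R)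
    (hM : 0 < M) (hw : IsHeatSolution w (closedBall x₀ R ×ˢ Icc (t₀ - R ^ 2) t₀))
    (hb : ∀ p ∈ closedBall x₀ R ×ˢ Icc (t₀ - R ^ 2) t₀, |w p.1 p.2| ≤ M) (i : Fin N)
    {h : ℝ} (h0 : 0 ≤ h) (hhR : h ≤ R) :
    |w (x₀ + h • 𝐞 i) t₀ - w (x₀ + (-h) • 𝐞 i) t₀| ≤ (4 * N + 6) / R * M * h := by
  rw [abs_le]
  have h1 := hw.sub_le_of_abs_le hR hM hb i h0 hhR
  have h2 := hw.neg.sub_le_of_abs_le hR hM (by simpa using hb) i h0 hhR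
  constructor <;> linarith

lemma abs_iteratedDeriv_two_le {f : ℝ → ℝ} (hf : ContDiffAt ℝ 2 f 0) {C : ℝ}
    (h : ∀ᶠ s in 𝓝[≥] (0 : ℝ), |f s + f (-s) - 2 * f 0| ≤ C * s ^ 2) :
    |iteratedDeriv 2 f 0| ≤ C := by
  have h' : ∀ᶠ s in 𝓝 (0 : ℝ), |f s + f (-s) - 2 * f 0| ≤ C * s ^ 2 := by
    obtain ⟨δ, hδ, hs⟩ := Metric.eventually_nhds_iff.mp (eventually_nhdsWithin_iff.mp h)
    refine Metric.eventually_nhds_iff.mpr ⟨δ, hδ, fun s hsδ => ?_⟩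
    rcases le_total 0 s with h0 | h0
    · exact hs hsδ h0
    · have := hs (y := -s) (by simpa using hsδ) (by simpa using h0)
      simpa [add_comm] using this
  have hneg : ContDiffAt ℝ 2 (fun s => f (-s)) 0 :=
    ContDiffAt.comp (g := f) 0 (by simpa using hf) (by fun_prop)
  have key : ∀ σ : ℝ, (∀ᶠ s in 𝓝 (0 : ℝ), σ * (f s + f (-s) - 2 * f 0) ≤ C * s ^ 2) →
      σ * iteratedDeriv 2 f 0 ≤ C := by
    intro σ hσ
    have hsym : ContDiffAt ℝ 2 (fun s => σ * (f s + f (-s))) 0 :=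
      contDiffAt_const.mul (hf.add hneg)
    have hg : ContDiffAt ℝ 2 (fun s => σ * (f s + f (-s)) - (2 * σ * f 0 + 0 * s + C * s ^ 2)) 0 :=
      hsym.sub (by fun_prop)
    have hmax : IsLocalMax (fun s => σ * (f s + f (-s)) - (2 * σ * f 0 + 0 * s + C * s ^ 2)) 0 := by
      filter_upwards [hσ] with s hs
      simp only [neg_zero]
      nlinarith
    have h1 := iteratedDeriv_two_nonpos_of_isLocalMax hg hmax
    have h2 := iteratedDeriv_sub (n := 2) (x := (0 : ℝ)) (f := fun s => σ * (f s + f (-s)))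
      (g := fun s => 2 * σ * f 0 + 0 * s + C * s ^ 2) hsym (by fun_prop)
    have h3 : iteratedDeriv 2 (fun s => σ * (f s + f (-s))) 0 = σ * (2 * iteratedDeriv 2 f 0) := by
      rw [iteratedDeriv_const_mul_field]
      congr 1
      refine (iteratedDeriv_add (n := 2) hf hneg).trans ?_
      rw [iteratedDeriv_comp_neg]
      simp
      ring
    rw [h3, iteratedDeriv_two_quadratic] at h2
    have h4 := h2.symm.trans_le h1
    linarith
  rw [abs_le]
  have h1 := key 1 (h'.mono fun s hs => by have := abs_le.mp hs; linarith)
  have h2 := key (-1) (h'.mono fun s hs => by have := abs_le.mp hs; linarith)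
  constructor <;> linarith

/-- Second spatial derivatives of a classical solution are locally bounded. -/
lemma IsHeatSolution.exists_nhds_bound {u : 𝔼 → ℝ → ℝ} {S : Set (𝔼 × ℝ)} (hS : IsOpen S)
    (hu : IsHeatSolution u S) {p₀ : 𝔼 × ℝ} (hp₀ : p₀ ∈ S) :
    ∃ C : ℝ, ∀ᶠ p in 𝓝 p₀, ∀ i : Fin N,
      |iteratedDeriv 2 (fun h : ℝ => u (p.1 + h • 𝐞 i) p.2) 0| ≤ C := by
  obtain ⟨x₀, t₀⟩ := p₀
  have hcont : ContinuousAt (fun p : 𝔼 × ℝ => u p.1 p.2) (x₀, t₀) :=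
    (hu.1 _ hp₀).continuousAt (hS.mem_nhds hp₀)
  set M : ℝ := |u x₀ t₀| + 1 with hM
  have hMpos : 0 < M := by positivity
  have hev : ∀ᶠ p : 𝔼 × ℝ in 𝓝 (x₀, t₀), p ∈ S ∧ |u p.1 p.2| ≤ M := by
    refine Filter.Eventually.and (hS.mem_nhds hp₀) ?_
    have := hcont.abs.eventually (gt_mem_nhds (show |u x₀ t₀| < M by linarith))
    exact this.mono fun p hp => le_of_lt hp
  obtain ⟨r, hr, hrS⟩ := Metric.eventually_nhds_iff.mp hev
  obtain ⟨R, hR, hR1, hRr⟩ : ∃ R : ℝ, 0 < R ∧ R ≤ 1 ∧ 4 * R < r := by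
    refine ⟨min 1 (r / 5), by positivity, min_le_left _ _, ?_⟩
    have := min_le_right 1 (r / 5)
    linarith
  have hR2 : R ^ 2 ≤ R := by nlinarith
  have hbox : ∀ p : 𝔼 × ℝ, ‖p.1 - x₀‖ ≤ 4 * R → |p.2 - t₀| ≤ 3 * R → p ∈ S ∧ |u p.1 p.2| ≤ M := by
    intro p h1 h2
    refine hrS ?_
    rw [Prod.dist_eq, dist_eq_norm, Real.dist_eq]
    exact max_lt (by linarith) (by linarith)
  set C : ℝ := (4 * N + 6) / R with hC
  have hCpos : 0 < C := by positivity
  have h1 : ∀ (x : 𝔼) (t : ℝ) (i : Fin N) (h : ℝ), ‖x - x₀‖ ≤ 2 * R → |t - t₀| ≤ 2 * R → 0 ≤ h →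
      h ≤ R → |u (x + h • 𝐞 i) t - u (x + (-h) • 𝐞 i) t| ≤ C * M * h := by
    intro x t i h hx ht h0 hhR
    have hsub : ∀ p ∈ closedBall x R ×ˢ Icc (t - R ^ 2) t, p ∈ S ∧ |u p.1 p.2| ≤ M := by
      rintro p ⟨hp1, hp2⟩
      rw [mem_closedBall, dist_eq_norm] at hp1
      refine hbox p ?_ ?_
      · have := norm_sub_le_norm_sub_add_norm_sub p.1 x x₀
        linarith
      · have := abs_le.mp ht
        exact abs_le.mpr ⟨by linarith [hp2.1], by linarith [hp2.2]⟩
    exact (hu.mono fun p hp => (hsub p hp).1).abs_sub_le_of_abs_le hR hMpos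
      (fun p hp => (hsub p hp).2) i h0 hhR
  refine ⟨C * (C * M) / 4, ?_⟩
  have hnear : ∀ᶠ p : 𝔼 × ℝ in 𝓝 (x₀, t₀), dist p (x₀, t₀) < R := Metric.ball_mem_nhds _ hR
  filter_upwards [hnear] with p hp i
  obtain ⟨x, t⟩ := p
  rw [Prod.dist_eq, max_lt_iff, dist_eq_norm, Real.dist_eq] at hp
  obtain ⟨hx, ht⟩ := hp
  dsimp only at hx ht ⊢
  refine abs_iteratedDeriv_two_le (contDiffAt_line (hu.2 (x, t) (hbox (x, t) (by dsimp; linarith)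
    (by dsimp; linarith)).1).1 (𝐞 i)) ?_
  filter_upwards [Icc_mem_nhdsGE hR] with s hs
  rcases hs.1.eq_or_lt with rfl | hs0
  · simp; linarith
  have hn : ∀ σ : ℝ, |σ| ≤ R → ‖σ • (𝐞 i)‖ ≤ R := by
    intro σ hσ
    simpa [norm_smul] using hσ
  set h := s / 2 with hh
  have hhpos : 0 < h := by positivity
  have hhR : h ≤ R := by linarith [hs.2]
  have hsub : ∀ p ∈ closedBall x R ×ˢ Icc (t - R ^ 2) t,
      ‖p.1 - x₀‖ ≤ 2 * R ∧ |p.2 - t₀| ≤ 2 * R := by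
    rintro p ⟨hp1, hp2⟩
    rw [mem_closedBall, dist_eq_norm] at hp1
    refine ⟨?_, ?_⟩
    · have := norm_sub_le_norm_sub_add_norm_sub p.1 x x₀
      linarith
    · have := abs_lt.mp ht
      exact abs_le.mpr ⟨by linarith [hp2.1], by linarith [hp2.2]⟩
  have hshift : ∀ σ : ℝ, |σ| ≤ R → ∀ p ∈ closedBall x R ×ˢ Icc (t - R ^ 2) t,
      (p.1 + σ • (𝐞 i), p.2) ∈ S := by
    intro σ hσ p hp
    refine (hbox (p.1 + σ • (𝐞 i), p.2) ?_ ?_).1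
    · have h1 := (hsub p hp).1
      have h2 := hn σ hσ
      have h3 := norm_add_le (p.1 - x₀) (σ • 𝐞 i)
      have h4 : p.1 + σ • (𝐞 i) - x₀ = p.1 - x₀ + σ • 𝐞 i := by abel
      dsimp only
      rw [h4]; linarith
    · have := (hsub p hp).2
      dsimp only; linarith
  have hw : IsHeatSolution (fun x t => u (x + h • 𝐞 i) t - u (x + (-h) • 𝐞 i) t)
      (closedBall x R ×ˢ Icc (t - R ^ 2) t) :=
    (hu.comp_add_right _ (hshift h (by rwa [abs_of_pos hhpos]))).sub
      (hu.comp_add_right _ (hshift (-h) (by rwa [abs_neg, abs_of_pos hhpos])))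
  have h2 := hw.abs_sub_le_of_abs_le hR (by positivity : 0 < C * M * h)
    (fun p hp => h1 p.1 p.2 i h (hsub p hp).1 (hsub p hp).2 hhpos.le hhR) i hhpos.le hhR
  have e1 : x + h • (𝐞 i) + h • (𝐞 i) = x + s • 𝐞 i := by rw [hh]; module
  have e2 : x + (-h) • (𝐞 i) + (-h) • (𝐞 i) = x + (-s) • 𝐞 i := by rw [hh]; module
  have e3 : x + h • (𝐞 i) + (-h) • (𝐞 i) = x := by module
  have e4 : x + (-h) • (𝐞 i) + h • (𝐞 i) = x := by module
  rw [e1, e2, e3, e4] at h2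
  have e5 : u (x + s • 𝐞 i) t + u (x + (-s) • 𝐞 i) t - 2 * u (x + (0 : ℝ) • 𝐞 i) t =
      u (x + s • 𝐞 i) t - u x t - (u x t - u (x + (-s) • 𝐞 i) t) := by
    rw [zero_smul, add_zero]; ring
  rw [e5]
  refine h2.trans (le_of_eq ?_)
  rw [hh, ← hC]; ring

/-- Second spatial derivatives of a classical solution are bounded on compact sets. -/
lemma IsHeatSolution.exists_bound {u : 𝔼 → ℝ → ℝ} {S K : Set (𝔼 × ℝ)} (hS : IsOpen S)
    (hu : IsHeatSolution u S) (hK : IsCompact K) (hKS : K ⊆ S) :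
    ∃ C : ℝ, ∀ p ∈ K, ∀ i : Fin N,
      |iteratedDeriv 2 (fun h : ℝ => u (p.1 + h • 𝐞 i) p.2) 0| ≤ C := by
  refine hK.induction_on (p := fun K => ∃ C : ℝ, ∀ p ∈ K, ∀ i : Fin N,
      |iteratedDeriv 2 (fun h : ℝ => u (p.1 + h • 𝐞 i) p.2) 0| ≤ C) ⟨0, by simp⟩ ?_ ?_ ?_
  · rintro s t hst ⟨C, hC⟩
    exact ⟨C, fun p hp => hC p (hst hp)⟩
  · rintro s t ⟨C, hC⟩ ⟨C', hC'⟩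
    refine ⟨max C C', fun p hp i => ?_⟩
    rcases hp with hp | hp
    · exact (hC p hp i).trans (le_max_left _ _)
    · exact (hC' p hp i).trans (le_max_right _ _)
  · intro p hp
    obtain ⟨C, hC⟩ := hu.exists_nhds_bound hS (hKS hp)
    exact ⟨_, mem_nhdsWithin_of_mem_nhds hC, C, fun q hq => hq⟩

/-- A test function on `univ × I` supported over `K`, bundled with its time derivative and its
pure spatial derivatives of order one and two. -/
structure IsTest (K : Set 𝔼) (I : Set ℝ) (φ φt : 𝔼 → ℝ → ℝ) (φi φii : Fin N → 𝔼 → ℝ → ℝ) :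
    Prop where
  cont : ContinuousOn (fun p : 𝔼 × ℝ => φ p.1 p.2) (univ ×ˢ I)
  cont_t : ContinuousOn (fun p : 𝔼 × ℝ => φt p.1 p.2) (univ ×ˢ I)
  cont_i : ∀ i, ContinuousOn (fun p : 𝔼 × ℝ => φi i p.1 p.2) (univ ×ˢ I)
  cont_ii : ∀ i, ContinuousOn (fun p : 𝔼 × ℝ => φii i p.1 p.2) (univ ×ˢ I)
  deriv_t : ∀ y, ∀ s ∈ I, HasDerivAt (φ y) (φt y s) s
  deriv_i : ∀ i y, ∀ s ∈ I, HasLineDerivAt ℝ (fun y => φ y s) (φi i y s) y (𝐞 i)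
  deriv_ii : ∀ i y, ∀ s ∈ I, HasLineDerivAt ℝ (fun y => φi i y s) (φii i y s) y (𝐞 i)
  zero : ∀ y, y ∉ K → ∀ s ∈ I, φ y s = 0 ∧ φt y s = 0 ∧ (∀ i, φi i y s = 0) ∧ ∀ i, φii i y s = 0

lemma IsTest.mono {K : Set 𝔼} {I I' : Set ℝ} {φ φt : 𝔼 → ℝ → ℝ} {φi φii : Fin N → 𝔼 → ℝ → ℝ}
    (h : IsTest K I φ φt φi φii) (hI : I' ⊆ I) : IsTest K I' φ φt φi φii where
  cont := h.cont.mono (prod_mono_right hI)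
  cont_t := h.cont_t.mono (prod_mono_right hI)
  cont_i i := (h.cont_i i).mono (prod_mono_right hI)
  cont_ii i := (h.cont_ii i).mono (prod_mono_right hI)
  deriv_t y s hs := h.deriv_t y s (hI hs)
  deriv_i i y s hs := h.deriv_i i y s (hI hs)
  deriv_ii i y s hs := h.deriv_ii i y s (hI hs)
  zero y hy s hs := h.zero y hy s (hI hs)

lemma continuousOn_slice {E : Type*} [TopologicalSpace E] {f : E → ℝ → ℝ} {K : Set E} {I : Set ℝ}
    (hf : ContinuousOn (fun p : E × ℝ => f p.1 p.2) (K ×ˢ I)) {s : ℝ} (hs : s ∈ I) :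
    ContinuousOn (fun y => f y s) K :=
  hf.comp (f := fun y => (y, s)) (by fun_prop) fun _ hy => ⟨hy, hs⟩

lemma integrable_mul_of_zero_off {f g : 𝔼 → ℝ} {K : Set 𝔼} (hK : IsCompact K)
    (hf : ContinuousOn f K) (hg : ContinuousOn g K) (h0 : ∀ y, y ∉ K → g y = 0) :
    Integrable (fun y => f y * g y) := by
  have h1 : IntegrableOn (fun y => f y * g y) K := (hf.mul hg).integrableOn_compact hK
  refine (integrableOn_iff_integrable_of_support_subset ?_).mp h1
  intro y hy
  by_contra hyK
  exact hy (by simp [h0 y hyK])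

lemma lineDeriv_facts {g : 𝔼 → ℝ} {y : 𝔼} (hg : ContDiffAt ℝ 2 g y) (v : 𝔼) :
    HasLineDerivAt ℝ g (deriv (fun h : ℝ => g (y + h • v)) 0) y v ∧
    HasLineDerivAt ℝ (fun y => deriv (fun h : ℝ => g (y + h • v)) 0)
      (iteratedDeriv 2 (fun h : ℝ => g (y + h • v)) 0) y v := by
  have hL := contDiffAt_line hg v
  refine ⟨(hL.differentiableAt (by norm_num)).hasDerivAt, ?_⟩
  have h1 : (fun h : ℝ => deriv (fun k : ℝ => g (y + h • v + k • v)) 0) =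
      deriv (fun h : ℝ => g (y + h • v)) := by
    funext h
    have := deriv_comp_const_add (fun k : ℝ => g (y + k • v)) h 0
    simp only [add_zero] at this
    rw [← this]
    congr 1
    funext k
    rw [add_smul, add_assoc]
  unfold HasLineDerivAt
  rw [h1, iteratedDeriv_succ, iteratedDeriv_one]
  refine DifferentiableAt.hasDerivAt ?_
  have hd : ContDiffAt ℝ 1 (fun h => fderiv ℝ (fun h : ℝ => g (y + h • v)) h 1) 0 :=
    (hL.fderiv_right (m := 1) (by norm_num)).clm_apply contDiffAt_const
  simp only [fderiv_apply_one_eq_deriv] at hd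
  exact hd.differentiableAt (by norm_num)

lemma continuousAt_lineDerivs {g : 𝔼 → ℝ} {y : 𝔼} (hg : ContDiffAt ℝ 2 g y) (v : 𝔼) :
    ContinuousAt (fun y => deriv (fun h : ℝ => g (y + h • v)) 0) y ∧
    ContinuousAt (fun y => iteratedDeriv 2 (fun h : ℝ => g (y + h • v)) 0) y := by
  have hev : ∀ᶠ z in 𝓝 y, ContDiffAt ℝ 2 g z := hg.eventually (by simp)
  have h1 : (fun y => deriv (fun h : ℝ => g (y + h • v)) 0) =ᶠ[𝓝 y] fun z => fderiv ℝ g z v := by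
    filter_upwards [hev] with z hz
    exact ((hz.differentiableAt (by norm_num)).hasFDerivAt.hasLineDerivAt v).lineDeriv
  have hC1 : ContDiffAt ℝ 1 (fun z => fderiv ℝ g z v) y :=
    (hg.fderiv_right (m := 1) (by norm_num)).clm_apply contDiffAt_const
  refine ⟨hC1.continuousAt.congr h1.symm, ?_⟩
  have hev1 : ∀ᶠ z in 𝓝 y, ContDiffAt ℝ 1 (fun z => fderiv ℝ g z v) z := hC1.eventually (by simp)
  have h2 : (fun y => iteratedDeriv 2 (fun h : ℝ => g (y + h • v)) 0) =ᶠ[𝓝 y]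
      fun z => fderiv ℝ (fun z => fderiv ℝ g z v) z v := by
    filter_upwards [hev, hev1, h1.eventually_nhds] with z hz hz1 hz2
    have a := (lineDeriv_facts hz v).2.lineDeriv
    have b := ((hz1.differentiableAt (by norm_num)).hasFDerivAt.hasLineDerivAt v).lineDeriv
    rw [← a, ← b]
    exact Filter.EventuallyEq.lineDeriv_eq hz2
  have hC0 : ContinuousAt (fun z => fderiv ℝ (fun z => fderiv ℝ g z v) z v) y :=
    ((hC1.fderiv_right (m := 0) (by norm_num)).clm_apply contDiffAt_const).continuousAt
  exact hC0.congr h2.symm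

/-- Integration by parts, twice, against a compactly supported function. -/
lemma integral_mul_second_deriv {g f f₁ f₂ : 𝔼 → ℝ} {v : 𝔼} {K : Set 𝔼} (hK : IsCompact K)
    (hg : ∀ y ∈ K, ContDiffAt ℝ 2 g y) (hf₁ : ∀ y, HasLineDerivAt ℝ f (f₁ y) y v)
    (hf₂ : ∀ y, HasLineDerivAt ℝ f₁ (f₂ y) y v) (hc : ContinuousOn f K) (hc₁ : ContinuousOn f₁ K)
    (hc₂ : ContinuousOn f₂ K) (h0 : ∀ y, y ∉ K → f y = 0) (h1 : ∀ y, y ∉ K → f₁ y = 0)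
    (h2 : ∀ y, y ∉ K → f₂ y = 0) :
    ∫ y, g y * f₂ y = ∫ y, iteratedDeriv 2 (fun h : ℝ => g (y + h • v)) 0 * f y := by
  have cg : ContinuousOn g K := fun y hy => (hg y hy).continuousAt.continuousWithinAt
  have cg1 : ContinuousOn (fun y => deriv (fun h : ℝ => g (y + h • v)) 0) K := fun y hy =>
    (continuousAt_lineDerivs (hg y hy) v).1.continuousWithinAt
  have cg2 : ContinuousOn (fun y => iteratedDeriv 2 (fun h : ℝ => g (y + h • v)) 0) K :=
    fun y hy => (continuousAt_lineDerivs (hg y hy) v).2.continuousWithinAt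
  have hts : ∀ q : 𝔼 → ℝ, (∀ y, y ∉ K → q y = 0) → tsupport q ⊆ K := fun q hq =>
    closure_minimal (fun y hy => by by_contra hyK; exact hy (hq y hyK)) hK.isClosed
  have e1 := integral_bilinear_hasLineDerivAt_right_eq_neg_left_of_integrable
    (μ := (volume : Measure 𝔼)) (B := ContinuousLinearMap.mul ℝ ℝ) (f := g) (g := f₁) (g' := f₂)
    (v := v) (f' := fun y => deriv (fun h : ℝ => g (y + h • v)) 0)
    (integrable_mul_of_zero_off hK cg1 hc₁ h1) (integrable_mul_of_zero_off hK cg hc₂ h2)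
    (integrable_mul_of_zero_off hK cg hc₁ h1)
    (fun y hy => (lineDeriv_facts (hg y (hts f₁ h1 hy)) v).1) (fun y _ => hf₂ y)
  have e2 := integral_bilinear_hasLineDerivAt_right_eq_neg_left_of_integrable
    (μ := (volume : Measure 𝔼)) (B := ContinuousLinearMap.mul ℝ ℝ)
    (f := fun y => deriv (fun h : ℝ => g (y + h • v)) 0) (g := f) (g' := f₁)
    (v := v) (f' := fun y => iteratedDeriv 2 (fun h : ℝ => g (y + h • v)) 0)
    (integrable_mul_of_zero_off hK cg2 hc h0) (integrable_mul_of_zero_off hK cg1 hc₁ h1)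
    (integrable_mul_of_zero_off hK cg1 hc h0)
    (fun y hy => (lineDeriv_facts (hg y (hts f h0 hy)) v).2) (fun y _ => hf₁ y)
  simp only [ContinuousLinearMap.mul_apply'] at e1 e2
  rw [e1, e2, neg_neg]

lemma continuousOn_mul_of_zero_off {u ψ : 𝔼 → ℝ → ℝ} {S : Set (𝔼 × ℝ)} (hS : IsOpen S)
    (hu : ContinuousOn (fun p : 𝔼 × ℝ => u p.1 p.2) S) {K : Set 𝔼} (hK : IsClosed K) {I : Set ℝ}
    (hKS : K ×ˢ I ⊆ S) (hψ : ContinuousOn (fun p : 𝔼 × ℝ => ψ p.1 p.2) (univ ×ˢ I))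
    (h0 : ∀ y, y ∉ K → ∀ s ∈ I, ψ y s = 0) :
    ContinuousOn (Function.uncurry fun s y => u y s * ψ y s) (I ×ˢ univ) := by
  rintro ⟨s, y⟩ ⟨hs, -⟩
  by_cases hy : y ∈ K
  · have h1 : ContinuousAt (fun p : ℝ × 𝔼 => u p.2 p.1) (s, y) :=
      ContinuousAt.comp (g := fun p : 𝔼 × ℝ => u p.1 p.2) (f := Prod.swap)
        (hu.continuousAt (hS.mem_nhds (hKS ⟨hy, hs⟩))) continuous_swap.continuousAt
    have h2 : ContinuousWithinAt (fun p : ℝ × 𝔼 => ψ p.2 p.1) (I ×ˢ univ) (s, y) :=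
      ContinuousWithinAt.comp (g := fun p : 𝔼 × ℝ => ψ p.1 p.2) (f := Prod.swap)
        (t := univ ×ˢ I) (hψ (y, s) ⟨mem_univ _, hs⟩) continuous_swap.continuousWithinAt
        fun p hp => ⟨mem_univ _, hp.1⟩
    exact h1.continuousWithinAt.mul h2
  · have hev : (Function.uncurry fun s y => u y s * ψ y s) =ᶠ[𝓝[I ×ˢ univ] (s, y)] fun _ => 0 := by
      have h1 : ∀ᶠ p : ℝ × 𝔼 in 𝓝 (s, y), p.2 ∈ Kᶜ :=
        (hK.isOpen_compl.preimage continuous_snd).mem_nhds hy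
      filter_upwards [mem_nhdsWithin_of_mem_nhds h1, self_mem_nhdsWithin] with p hp1 hp2
      simp [Function.uncurry, h0 p.2 hp1 p.1 hp2.1]
    refine continuousWithinAt_const.congr_of_eventuallyEq hev ?_
    simp [Function.uncurry, h0 y hy s hs]

/-- Weak formulation of the heat equation for test functions supported in the domain. -/
lemma IsHeatSolution.integral_test {u : 𝔼 → ℝ → ℝ} {S : Set (𝔼 × ℝ)} (hS : IsOpen S)
    (hu : IsHeatSolution u S) {K : Set 𝔼} (hK : IsCompact K) {a b : ℝ} (hab : a ≤ b)
    (hKS : K ×ˢ Icc a b ⊆ S) {φ φt : 𝔼 → ℝ → ℝ} {φi φii : Fin N → 𝔼 → ℝ → ℝ}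
    (hφ : IsTest K (Icc a b) φ φt φi φii) :
    IntervalIntegrable (fun s => ∫ y, u y s * (φt y s + ∑ i, φii i y s)) volume a b ∧
    ∫ s in a..b, ∫ y, u y s * (φt y s + ∑ i, φii i y s) =
      (∫ y, u y b * φ y b) - ∫ y, u y a * φ y a := by
  set lap : 𝔼 → ℝ → ℝ := fun y s =>
    ∑ i, iteratedDeriv 2 (fun h : ℝ => u (y + h • 𝐞 i) s) 0 with hlap
  have hH : ContinuousOn (fun p : 𝔼 × ℝ => φt p.1 p.2 + ∑ i, φii i p.1 p.2) (univ ×ˢ Icc a b) :=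
    hφ.cont_t.add (continuousOn_finsetSum _ fun i _ => hφ.cont_ii i)
  have hH0 : ∀ y, y ∉ K → ∀ s ∈ Icc a b, φt y s + ∑ i, φii i y s = 0 := by
    intro y hy s hs
    obtain ⟨-, h1, -, h2⟩ := hφ.zero y hy s hs
    simp [h1, h2]
  have hJ : ContinuousOn (fun s => ∫ y, u y s * (φt y s + ∑ i, φii i y s)) (Icc a b) :=
    continuousOn_integral_of_compact_support hK
      (continuousOn_mul_of_zero_off hS hu.1 hK.isClosed hKS (ψ := fun y s =>
        φt y s + ∑ i, φii i y s) hH hH0)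
      fun s y hs hy => by simp [hH0 y hy s hs]
  have hM : ContinuousOn (fun s => ∫ y, u y s * φ y s) (Icc a b) :=
    continuousOn_integral_of_compact_support hK
      (continuousOn_mul_of_zero_off hS hu.1 hK.isClosed hKS (ψ := φ) hφ.cont
        fun y hy s hs => (hφ.zero y hy s hs).1)
      fun s y hs hy => by simp [(hφ.zero y hy s hs).1]
  have hJi : IntervalIntegrable (fun s => ∫ y, u y s * (φt y s + ∑ i, φii i y s)) volume a b :=
    hJ.intervalIntegrable_of_Icc hab
  refine ⟨hJi, ?_⟩
  refine intervalIntegral.integral_eq_sub_of_hasDerivAt_of_le hab hM ?_ hJi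
  intro s hs
  have hsI : s ∈ Icc a b := Ioo_subset_Icc_self hs
  have hKc : IsCompact (K ×ˢ Icc a b) := hK.prod isCompact_Icc
  obtain ⟨C, hC⟩ := hu.exists_bound hS hKc hKS
  obtain ⟨A, hA⟩ := hKc.exists_bound_of_continuousOn (hφ.cont.mono (prod_mono_left (subset_univ K)))
  obtain ⟨A', hA'⟩ := hKc.exists_bound_of_continuousOn
    ((hu.1.mono hKS).mul (hφ.cont_t.mono (prod_mono_left (subset_univ K))))
  have cu : ∀ s ∈ Icc a b, ContinuousOn (fun y => u y s) K := fun s hs =>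
    continuousOn_slice (hu.1.mono hKS) hs
  have cφ : ∀ s ∈ Icc a b, ContinuousOn (fun y => φ y s) K := fun s hs =>
    (continuousOn_slice hφ.cont hs).mono (subset_univ K)
  have cφt : ∀ s ∈ Icc a b, ContinuousOn (fun y => φt y s) K := fun s hs =>
    (continuousOn_slice hφ.cont_t hs).mono (subset_univ K)
  have cφi : ∀ i, ∀ s ∈ Icc a b, ContinuousOn (fun y => φi i y s) K := fun i s hs =>
    (continuousOn_slice (hφ.cont_i i) hs).mono (subset_univ K)
  have cφii : ∀ i, ∀ s ∈ Icc a b, ContinuousOn (fun y => φii i y s) K := fun i s hs =>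
    (continuousOn_slice (hφ.cont_ii i) hs).mono (subset_univ K)
  have cu2 : ∀ i, ContinuousOn
      (fun y => iteratedDeriv 2 (fun h : ℝ => u (y + h • 𝐞 i) s) 0) K := fun i y hy =>
    (continuousAt_lineDerivs (hu.2 (y, s) (hKS ⟨hy, hsI⟩)).1 (𝐞 i)).2.continuousWithinAt
  have clap : ContinuousOn (fun y => lap y s) K :=
    continuousOn_finsetSum _ fun i _ => cu2 i
  have z := fun y hy => (hφ.zero y hy s hsI).1
  have zt := fun y hy => (hφ.zero y hy s hsI).2.1
  have i1 : Integrable (fun y => lap y s * φ y s) :=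
    integrable_mul_of_zero_off hK clap (cφ s hsI) z
  have i2 : Integrable (fun y => u y s * φt y s) :=
    integrable_mul_of_zero_off hK (cu s hsI) (cφt s hsI) zt
  have key := hasDerivAt_integral_of_dominated_loc_of_deriv_le (μ := (volume : Measure 𝔼))
    (F := fun s y => u y s * φ y s) (F' := fun s y => lap y s * φ y s + u y s * φt y s)
    (x₀ := s) (s := Ioo a b) (bound := K.indicator fun _ => N * C * A + A')
    (Ioo_mem_nhds hs.1 hs.2) ?_
    (integrable_mul_of_zero_off hK (cu s hsI) (cφ s hsI) z)
    (i1.add i2).aestronglyMeasurable ?_ ?_ ?_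
  · refine key.2.congr_deriv ?_
    have e : ∀ i, ∫ y, u y s * φii i y s =
        ∫ y, iteratedDeriv 2 (fun h : ℝ => u (y + h • 𝐞 i) s) 0 * φ y s := fun i =>
      integral_mul_second_deriv hK (fun y hy => (hu.2 (y, s) (hKS ⟨hy, hsI⟩)).1)
        (fun y => hφ.deriv_i i y s hsI) (fun y => hφ.deriv_ii i y s hsI) (cφ s hsI) (cφi i s hsI)
        (cφii i s hsI) z (fun y hy => (hφ.zero y hy s hsI).2.2.1 i)
        (fun y hy => (hφ.zero y hy s hsI).2.2.2 i)
    have i3 : ∀ i, Integrable fun y => u y s * φii i y s := fun i =>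
      integrable_mul_of_zero_off hK (cu s hsI) (cφii i s hsI)
        (fun y hy => (hφ.zero y hy s hsI).2.2.2 i)
    have i4 : ∀ i, Integrable fun y =>
        iteratedDeriv 2 (fun h : ℝ => u (y + h • 𝐞 i) s) 0 * φ y s := fun i =>
      integrable_mul_of_zero_off hK (cu2 i) (cφ s hsI) z
    rw [integral_add i1 i2]
    simp only [hlap, mul_add, Finset.sum_mul, Finset.mul_sum]
    rw [integral_add i2 (integrable_finsetSum _ fun i _ => i3 i),
      integral_finsetSum _ (fun i _ => i4 i), integral_finsetSum _ (fun i _ => i3 i), add_comm]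
    simp only [e]
  · filter_upwards [Ioo_mem_nhds hs.1 hs.2] with τ hτ
    have hτI := Ioo_subset_Icc_self hτ
    exact (integrable_mul_of_zero_off hK (cu τ hτI) (cφ τ hτI)
      fun y hy => (hφ.zero y hy τ hτI).1).aestronglyMeasurable
  · refine Eventually.of_forall fun y τ hτ => ?_
    have hτI := Ioo_subset_Icc_self hτ
    by_cases hy : y ∈ K
    · rw [indicator_of_mem hy]
      have hp : (y, τ) ∈ K ×ˢ Icc a b := ⟨hy, hτI⟩
      refine (norm_add_le _ _).trans (add_le_add ?_ (hA' _ hp))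
      rw [norm_mul]
      have hl : ‖lap y τ‖ ≤ N * C := by
        refine (norm_sum_le _ _).trans ?_
        refine (Finset.sum_le_card_nsmul _ _ C fun i _ => hC _ hp i).trans ?_
        simp
      exact mul_le_mul hl (hA _ hp) (norm_nonneg _) ((norm_nonneg _).trans hl)
    · obtain ⟨h1, h2, -⟩ := hφ.zero y hy τ hτI
      simp [h1, h2, hy]
  · exact (integrable_indicator_iff hK.measurableSet).mpr
      (integrableOn_const hK.measure_lt_top.ne)
  · refine Eventually.of_forall fun y τ hτ => ?_
    have hτI := Ioo_subset_Icc_self hτ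
    by_cases hy : y ∈ K
    · exact (hu.2 (y, τ) (hKS ⟨hy, hτI⟩)).2.mul (hφ.deriv_t y τ hτI)
    · obtain ⟨h1, h2, -⟩ := hφ.zero y hy τ hτI
      have hev : (fun τ => u y τ * φ y τ) =ᶠ[𝓝 τ] fun _ => 0 := by
        filter_upwards [Ioo_mem_nhds hτ.1 hτ.2] with σ hσ
        simp [(hφ.zero y hy σ (Ioo_subset_Icc_self hσ)).1]
      simp only [h1, h2, mul_zero, add_zero]
      exact (hasDerivAt_const τ (0 : ℝ)).congr_of_eventuallyEq hev

lemma norm_rpow_indicator_eq (r : ℝ) (x : 𝔼) :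
    (ball 0 r).indicator (fun y : 𝔼 => ‖y‖ ^ ((2 : ℝ) - N)) x =
      (Iio r).indicator (fun y : ℝ => y ^ ((2 : ℝ) - N)) ‖x‖ := by
  simp [indicator]

lemma pow_smul_rpow_indicator_eq (hN : 1 ≤ N) (r : ℝ) :
    EqOn (fun y : ℝ => y ^ (Module.finrank ℝ 𝔼 - 1) •
      (Iio r).indicator (fun y : ℝ => y ^ ((2 : ℝ) - N)) y)
      ((Iio r).indicator fun y : ℝ => y) (Ioi 0) := by
  intro y hy
  have hy0 : (0 : ℝ) < y := hy
  by_cases h : y ∈ Iio r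
  · simp only [indicator_of_mem h, finrank_euclideanSpace_fin, smul_eq_mul]
    rw [← rpow_natCast, ← rpow_add hy0, Nat.cast_sub hN]
    norm_num
  · simp [indicator_of_notMem h]

lemma integrableOn_norm_rpow (hN : 1 ≤ N) (r : ℝ) (x₀ : 𝔼) :
    IntegrableOn (fun y : 𝔼 => ‖y - x₀‖ ^ ((2 : ℝ) - N)) (ball x₀ r) := by
  have : Nontrivial 𝔼 := by
    have : Nonempty (Fin N) := ⟨⟨0, hN⟩⟩
    infer_instance
  have h0 : Integrable ((ball 0 r).indicator fun y : 𝔼 => ‖y‖ ^ ((2 : ℝ) - N)) := by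
    simp only [funext (norm_rpow_indicator_eq r)]
    rw [integrable_fun_norm_addHaar, integrableOn_congr_fun (pow_smul_rpow_indicator_eq hN r)
      measurableSet_Ioi, integrableOn_indicator_iff measurableSet_Iio]
    refine (continuous_id.integrableOn_Icc (a := (0 : ℝ)) (b := r)).mono_set ?_
    rintro y ⟨h1, h2⟩
    exact ⟨le_of_lt h2, le_of_lt h1⟩
  rw [← integrable_indicator_iff measurableSet_ball]
  refine (h0.comp_sub_right x₀).congr (Filter.Eventually.of_forall fun y => ?_)
  simp [indicator, dist_eq_norm]

lemma exists_integral_norm_rpow_le (hN : 1 ≤ N) :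
    ∃ C : ℝ, 0 ≤ C ∧ ∀ r : ℝ, 0 ≤ r → ∀ x₀ : 𝔼,
      ∫ y in ball x₀ r, ‖y - x₀‖ ^ ((2 : ℝ) - N) ≤ C * r ^ 2 := by
  have : Nontrivial 𝔼 := by
    have : Nonempty (Fin N) := ⟨⟨0, hN⟩⟩
    infer_instance
  refine ⟨N * (volume : Measure 𝔼).real (ball 0 1), by positivity, fun r hr x₀ => ?_⟩
  have h1 : ∫ y in ball x₀ r, ‖y - x₀‖ ^ ((2 : ℝ) - N) =
      ∫ y, (Iio r).indicator (fun y : ℝ => y ^ ((2 : ℝ) - N)) ‖(y : 𝔼)‖ := by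
    rw [← integral_indicator measurableSet_ball,
      ← integral_sub_right_eq_self
        (fun y : 𝔼 => (Iio r).indicator (fun y : ℝ => y ^ ((2 : ℝ) - N)) ‖y‖) x₀]
    congr 1
  have h2 : ∫ y in Ioi (0 : ℝ), (Iio r).indicator (fun y : ℝ => y) y ≤ r ^ 2 := by
    rw [setIntegral_indicator measurableSet_Iio, Ioi_inter_Iio, ← integral_Ioc_eq_integral_Ioo,
      ← intervalIntegral.integral_of_le hr, integral_id]
    nlinarith [sq_nonneg r]
  rw [h1, integral_fun_norm_addHaar, setIntegral_congr_fun measurableSet_Ioi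
    (pow_smul_rpow_indicator_eq hN r), finrank_euclideanSpace_fin, nsmul_eq_mul, smul_eq_mul,
    ← mul_assoc]
  exact mul_le_mul_of_nonneg_left h2 (by positivity)

lemma contDiff_lineDerivs_continuous {η : 𝔼 → ℝ} (hη : ContDiff ℝ 2 η) (v : 𝔼) :
    Continuous (fun y => deriv (fun h : ℝ => η (y + h • v)) 0) ∧
    Continuous (fun y => iteratedDeriv 2 (fun h : ℝ => η (y + h • v)) 0) :=
  ⟨continuous_iff_continuousAt.mpr fun _ => (continuousAt_lineDerivs hη.contDiffAt v).1,
    continuous_iff_continuousAt.mpr fun _ => (continuousAt_lineDerivs hη.contDiffAt v).2⟩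

lemma lineDerivs_congr {f g : 𝔼 → ℝ} {y : 𝔼} (h : f =ᶠ[𝓝 y] g) (v : 𝔼) :
    deriv (fun h : ℝ => f (y + h • v)) 0 = deriv (fun h : ℝ => g (y + h • v)) 0 ∧
    iteratedDeriv 2 (fun h : ℝ => f (y + h • v)) 0 =
      iteratedDeriv 2 (fun h : ℝ => g (y + h • v)) 0 := by
  have ht : Tendsto (fun h : ℝ => y + h • v) (𝓝 0) (𝓝 y) := by
    have : Continuous fun h : ℝ => y + h • v := by fun_prop
    simpa using this.tendsto 0
  have he : (fun h : ℝ => f (y + h • v)) =ᶠ[𝓝 0] fun h : ℝ => g (y + h • v) := ht.eventually h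
  exact ⟨he.deriv_eq, he.iteratedDeriv_eq 2⟩

/-- Multiplying a test function by a function of space vanishing on an open set. -/
lemma IsTest.mul {K O : Set 𝔼} {I : Set ℝ} {φ φt : 𝔼 → ℝ → ℝ} {φi φii : Fin N → 𝔼 → ℝ → ℝ}
    (hφ : IsTest K I φ φt φi φii) {η : 𝔼 → ℝ} (hη : ContDiff ℝ 2 η) (hO : IsOpen O)
    (h0 : ∀ y ∈ O, η y = 0) :
    IsTest (K \ O) I (fun y s => η y * φ y s) (fun y s => η y * φt y s)
      (fun i y s => deriv (fun h : ℝ => η (y + h • 𝐞 i)) 0 * φ y s + η y * φi i y s)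
      (fun i y s => iteratedDeriv 2 (fun h : ℝ => η (y + h • 𝐞 i)) 0 * φ y s +
        2 * deriv (fun h : ℝ => η (y + h • 𝐞 i)) 0 * φi i y s + η y * φii i y s) := by
  have hc0 : ContinuousOn (fun p : 𝔼 × ℝ => η p.1) (univ ×ˢ I) :=
    (hη.continuous.comp continuous_fst).continuousOn
  have hc1 : ∀ i : Fin N, ContinuousOn
      (fun p : 𝔼 × ℝ => deriv (fun h : ℝ => η (p.1 + h • 𝐞 i)) 0) (univ ×ˢ I) := fun i =>
    ((contDiff_lineDerivs_continuous hη (𝐞 i)).1.comp continuous_fst).continuousOn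
  have hc2 : ∀ i : Fin N, ContinuousOn
      (fun p : 𝔼 × ℝ => iteratedDeriv 2 (fun h : ℝ => η (p.1 + h • 𝐞 i)) 0) (univ ×ˢ I) :=
    fun i => ((contDiff_lineDerivs_continuous hη (𝐞 i)).2.comp continuous_fst).continuousOn
  have hmul : ∀ {f g : 𝔼 → ℝ} {f' g' : ℝ} {y v : 𝔼}, HasLineDerivAt ℝ f f' y v →
      HasLineDerivAt ℝ g g' y v →
      HasLineDerivAt ℝ (fun y => f y * g y) (f' * g y + f y * g') y v := by
    intro f g f' g' y v hf hg
    have := HasDerivAt.mul hf hg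
    simp only [zero_smul, add_zero] at this
    exact this
  refine ⟨hc0.mul hφ.cont, hc0.mul hφ.cont_t,
    fun i => ((hc1 i).mul hφ.cont).add (hc0.mul (hφ.cont_i i)),
    fun i => (((hc2 i).mul hφ.cont).add ((continuousOn_const.mul (hc1 i)).mul (hφ.cont_i i))).add
      (hc0.mul (hφ.cont_ii i)), fun y s hs => (hφ.deriv_t y s hs).const_mul _, fun i y s hs =>
      hmul (lineDeriv_facts hη.contDiffAt _).1 (hφ.deriv_i i y s hs), fun i y s hs => ?_, ?_⟩
  · have h1 := hmul (lineDeriv_facts (hη.contDiffAt (x := y)) (𝐞 i)).2 (hφ.deriv_i i y s hs)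
    have h2 := hmul (lineDeriv_facts (hη.contDiffAt (x := y)) (𝐞 i)).1 (hφ.deriv_ii i y s hs)
    exact (HasDerivAt.add h1 h2).congr_deriv (by ring)
  · intro y hy s hs
    by_cases hK : y ∈ K
    · have hyO : y ∈ O := by_contra fun h => hy ⟨hK, h⟩
      have hev : η =ᶠ[𝓝 y] fun _ => 0 := by
        filter_upwards [hO.mem_nhds hyO] with z hz using h0 z hz
      have hd := fun i : Fin N => lineDerivs_congr hev (𝐞 i)
      simp [fun i => (hd i).1, fun i => (hd i).2, h0 y hyO]
    · obtain ⟨h1, h2, h3, h4⟩ := hφ.zero y hK s hs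
      simp [h1, h2, h3, h4]

/-- Rescaled cutoff functions vanishing near a point, with bounds on their derivatives. -/
lemma exists_cutoff : ∃ M : ℝ, 0 < M ∧ ∀ (c : 𝔼) (ρ : ℝ), 0 < ρ → ∃ η : 𝔼 → ℝ,
    ContDiff ℝ 2 η ∧ (∀ y ∈ ball c (2 * ρ), η y = 0) ∧ (∀ y, |η y - 1| ≤ 1) ∧
    (∀ y, y ∉ closedBall c (3 * ρ) → η y = 1) ∧
    ∀ (i : Fin N) (y : 𝔼), |deriv (fun h : ℝ => η (y + h • 𝐞 i)) 0| ≤ M / ρ ∧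
      |iteratedDeriv 2 (fun h : ℝ => η (y + h • 𝐞 i)) 0| ≤ M / ρ ^ 2 := by
  let χ : ContDiffBump (0 : 𝔼) := ⟨2, 3, by norm_num, by norm_num⟩
  have hχ : ContDiff ℝ 2 χ := χ.contDiff
  have hfar : ∀ y, y ∉ closedBall (0 : 𝔼) 3 → (χ : 𝔼 → ℝ) =ᶠ[𝓝 y] fun _ => 0 := by
    intro y hy
    filter_upwards [isClosed_closedBall.isOpen_compl.mem_nhds hy] with z hz
    exact χ.zero_of_le_dist (le_of_lt (not_le.mp hz))
  have hbd : ∀ i : Fin N, ∃ M : ℝ, ∀ y : 𝔼, |deriv (fun h : ℝ => χ (y + h • 𝐞 i)) 0| ≤ M ∧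
      |iteratedDeriv 2 (fun h : ℝ => χ (y + h • 𝐞 i)) 0| ≤ M := by
    intro i
    obtain ⟨c1, c2⟩ := contDiff_lineDerivs_continuous hχ (𝐞 i)
    obtain ⟨M1, h1⟩ := (isCompact_closedBall (0 : 𝔼) 3).exists_bound_of_continuousOn
      c1.continuousOn
    obtain ⟨M2, h2⟩ := (isCompact_closedBall (0 : 𝔼) 3).exists_bound_of_continuousOn
      c2.continuousOn
    refine ⟨max (max M1 M2) 0, fun y => ?_⟩
    by_cases hy : y ∈ closedBall (0 : 𝔼) 3
    · exact ⟨(h1 y hy).trans (by simp), (h2 y hy).trans (by simp)⟩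
    · obtain ⟨e1, e2⟩ := lineDerivs_congr (hfar y hy) (𝐞 i)
      simp [e1, e2]
  choose M hM using hbd
  have hMle : ∀ i, M i ≤ ∑ j, |M j| + 1 := fun i =>
    (le_abs_self _).trans ((Finset.single_le_sum (f := fun j => |M j|)
      (fun j _ => abs_nonneg _) (Finset.mem_univ i)).trans (by linarith))
  refine ⟨∑ i, |M i| + 1, by positivity, fun c ρ hρ => ⟨fun y => 1 - χ (ρ⁻¹ • (y - c)),
    contDiff_const.sub (hχ.comp (by fun_prop)), fun y hy => ?_, fun y => ?_, fun y hy => ?_,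
    fun i y => ?_⟩⟩
  · have : χ (ρ⁻¹ • (y - c)) = 1 := by
      refine χ.one_of_mem_closedBall ?_
      rw [mem_closedBall_zero_iff, norm_smul, norm_inv, norm_of_nonneg hρ.le,
        inv_mul_le_iff₀ hρ, mul_comm]
      exact (mem_ball_iff_norm.mp hy).le
    simp [this]
  · have h1 := χ.nonneg (x := ρ⁻¹ • (y - c))
    have h2 := χ.le_one (x := ρ⁻¹ • (y - c))
    rw [abs_le]
    constructor <;> linarith
  · have : χ (ρ⁻¹ • (y - c)) = 0 := by
      refine χ.zero_of_le_dist ?_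
      rw [dist_zero_right, norm_smul, norm_inv, norm_of_nonneg hρ.le, le_inv_mul_iff₀ hρ, mul_comm]
      rw [mem_closedBall_iff_norm, not_le] at hy
      exact hy.le
    simp [this]
  · have hline : (fun h : ℝ => 1 - χ (ρ⁻¹ • (y + h • (𝐞 i) - c))) =
        fun h : ℝ => 1 - (fun k : ℝ => χ (ρ⁻¹ • (y - c) + k • 𝐞 i)) (ρ⁻¹ * h) := by
      funext h
      congr 2
      module
    have hL : ContDiff ℝ 2 fun k : ℝ => χ (ρ⁻¹ • (y - c) + k • 𝐞 i) :=
      hχ.comp (by fun_prop)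
    obtain ⟨b1, b2⟩ := hM i (ρ⁻¹ • (y - c))
    have e1 : deriv (fun h : ℝ => 1 - χ (ρ⁻¹ • (y + h • (𝐞 i) - c))) 0 =
        -(ρ⁻¹ * deriv (fun k : ℝ => χ (ρ⁻¹ • (y - c) + k • 𝐞 i)) 0) := by
      rw [hline, deriv_const_sub, deriv_comp_mul_left ρ⁻¹ fun k : ℝ => χ (ρ⁻¹ • (y - c) + k • 𝐞 i)]
      simp
    have e2 : iteratedDeriv 2 (fun h : ℝ => 1 - χ (ρ⁻¹ • (y + h • (𝐞 i) - c))) 0 =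
        -(ρ⁻¹ ^ 2 * iteratedDeriv 2 (fun k : ℝ => χ (ρ⁻¹ • (y - c) + k • 𝐞 i)) 0) := by
      have h2 := congrFun (iteratedDeriv_comp_const_mul hL ρ⁻¹) 0
      rw [hline, iteratedDeriv_const_sub two_pos, iteratedDeriv_neg]
      refine (congrArg Neg.neg h2).trans ?_
      simp
    rw [e1, e2, abs_neg, abs_neg, abs_mul, abs_mul, abs_of_pos (inv_pos.mpr hρ),
      abs_of_pos (by positivity : (0 : ℝ) < ρ⁻¹ ^ 2), div_eq_inv_mul, div_eq_inv_mul, inv_pow]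
    exact ⟨mul_le_mul_of_nonneg_left (b1.trans (hMle i)) (by positivity),
      mul_le_mul_of_nonneg_left (b2.trans (hMle i)) (by positivity)⟩

lemma eq_of_forall_abs_sub_le {f : ℝ → ℝ} {a b : ℝ} (hab : a ≤ b)
    (h : ∀ ε > 0, ∃ δ > 0, ∀ s ∈ Icc a b, ∀ s' ∈ Icc a b, s < s' → s' < s + δ →
      |f s' - f s| ≤ ε * (s' - s)) : f b = f a := by
  have h' : ∀ ε > 0, ∃ δ > 0, ∀ s ∈ Icc a b, ∀ s' ∈ Icc a b, |s' - s| < δ →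
      |f s' - f s| ≤ ε * |s' - s| := by
    intro ε hε
    obtain ⟨δ, hδ, H⟩ := h ε hε
    refine ⟨δ, hδ, fun s hs s' hs' hd => ?_⟩
    rcases lt_trichotomy s s' with hlt | heq | hlt
    · have := H s hs s' hs' hlt (by linarith [le_abs_self (s' - s)])
      rwa [abs_of_pos (sub_pos.mpr hlt)]
    · simp [heq]
    · have := H s' hs' s hs hlt (by linarith [neg_abs_le (s' - s)])
      rwa [abs_sub_comm (f s'), abs_sub_comm s', abs_of_pos (sub_pos.mpr hlt)]
  refine constant_of_has_deriv_right_zero (f := f) (a := a) (b := b) ?_ ?_ b (right_mem_Icc.mpr hab)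
  · intro s hs
    obtain ⟨δ, hδ, H⟩ := h' 1 one_pos
    rw [Metric.continuousWithinAt_iff]
    intro ε hε
    refine ⟨min δ ε, lt_min hδ hε, fun s' hs' hd => ?_⟩
    rw [Real.dist_eq] at hd ⊢
    have := H s hs s' hs' (hd.trans_le (min_le_left _ _))
    linarith [hd.trans_le (min_le_right _ _)]
  · intro s hs
    rw [hasDerivWithinAt_iff_isLittleO, Asymptotics.isLittleO_iff]
    intro ε hε
    obtain ⟨δ, hδ, H⟩ := h' ε hε
    have h1 : ∀ᶠ s' in 𝓝 s, |s' - s| < δ := by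
      have := Metric.ball_mem_nhds s hδ
      filter_upwards [this] with s' hs'
      simpa [Real.dist_eq] using hs'
    have h2 : ∀ᶠ s' in 𝓝 s, s' < b := eventually_lt_nhds hs.2
    filter_upwards [mem_nhdsWithin_of_mem_nhds h1, mem_nhdsWithin_of_mem_nhds h2,
      self_mem_nhdsWithin] with s' e1 e2 e3
    simpa using H s (Ico_subset_Icc_self hs) s' ⟨hs.1.trans e3, e2.le⟩ e1

/-- A solution of the heat equation on `K × [a, b]` away from the `1/2`-Hölder curve `ξ`, which is
negligible near the curve compared to the fundamental solution of the Laplace equation. -/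
structure IsSmallNear (u : 𝔼 → ℝ → ℝ) (ξ : ℝ → 𝔼) (S : Set (𝔼 × ℝ)) (K : Set 𝔼) (a b Λ : ℝ) :
    Prop where
  isOpen : IsOpen S
  heat : IsHeatSolution u S
  mem : ∀ y ∈ K, ∀ s ∈ Icc a b, y ≠ ξ s → (y, s) ∈ S
  isCompact : IsCompact K
  zero : ∀ s ∈ Icc a b, u (ξ s) s = 0
  nonneg : 0 ≤ Λ
  holder : ∀ s ∈ Icc a b, ∀ s' ∈ Icc a b, ‖ξ s - ξ s'‖ ≤ Λ * √|s - s'|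
  small : ∀ ε > 0, ∃ r > 0, ∀ s ∈ Icc a b, ∀ y, ‖y - ξ s‖ < r →
    |u y s| ≤ ε * ‖y - ξ s‖ ^ ((2 : ℝ) - N)

lemma continuousOn_of_norm_sub_le_sqrt {ξ : ℝ → 𝔼} {Λ : ℝ} {I : Set ℝ}
    (h : ∀ s ∈ I, ∀ s' ∈ I, ‖ξ s - ξ s'‖ ≤ Λ * √|s - s'|) : ContinuousOn ξ I := by
  intro s hs
  rw [ContinuousWithinAt, tendsto_iff_norm_sub_tendsto_zero]
  have h1 : Tendsto (fun s' => Λ * √|s' - s|) (𝓝[I] s) (𝓝 0) := by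
    have : Continuous fun s' => Λ * √|s' - s| := by fun_prop
    simpa using (this.tendsto s).mono_left nhdsWithin_le_nhds
  refine squeeze_zero' (Eventually.of_forall fun _ => norm_nonneg _) ?_ h1
  filter_upwards [self_mem_nhdsWithin] with s' hs' using h s' hs' s hs

lemma IsSmallNear.mono {u : 𝔼 → ℝ → ℝ} {ξ : ℝ → 𝔼} {S : Set (𝔼 × ℝ)}
    {K : Set 𝔼} {a b Λ : ℝ} (h : IsSmallNear u ξ S K a b Λ) {t : ℝ} (ht : t ≤ b) :
    IsSmallNear u ξ S K a t Λ where
  isOpen := h.isOpen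
  heat := h.heat
  mem y hy s hs := h.mem y hy s (Icc_subset_Icc_right ht hs)
  isCompact := h.isCompact
  zero s hs := h.zero s (Icc_subset_Icc_right ht hs)
  nonneg := h.nonneg
  holder s hs s' hs' := h.holder s (Icc_subset_Icc_right ht hs) s' (Icc_subset_Icc_right ht hs')
  small ε hε := by
    obtain ⟨r, hr, H⟩ := h.small ε hε
    exact ⟨r, hr, fun s hs => H s (Icc_subset_Icc_right ht hs)⟩

lemma IsSmallNear.continuousOn_dist {u : 𝔼 → ℝ → ℝ} {ξ : ℝ → 𝔼} {S : Set (𝔼 × ℝ)}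
    {K : Set 𝔼} {a b Λ : ℝ} (h : IsSmallNear u ξ S K a b Λ) :
    ContinuousOn (fun p : 𝔼 × ℝ => ‖p.1 - ξ p.2‖) (K ×ˢ Icc a b) :=
  (continuousOn_fst.sub ((continuousOn_of_norm_sub_le_sqrt h.holder).comp continuousOn_snd
    fun _ hp => hp.2)).norm

lemma IsSmallNear.exists_bound {u : 𝔼 → ℝ → ℝ} {ξ : ℝ → 𝔼} {S : Set (𝔼 × ℝ)}
    {K : Set 𝔼} {a b Λ : ℝ} (h : IsSmallNear u ξ S K a b Λ) :
    ∃ C : ℝ, 0 ≤ C ∧ ∀ s ∈ Icc a b, ∀ y ∈ K, |u y s| ≤ ‖y - ξ s‖ ^ ((2 : ℝ) - N) + C := by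
  obtain ⟨r, hr, H⟩ := h.small 1 one_pos
  have hc : IsCompact ((K ×ˢ Icc a b) ∩ (fun p : 𝔼 × ℝ => ‖p.1 - ξ p.2‖) ⁻¹' Ici r) := by
    refine (h.isCompact.prod isCompact_Icc).of_isClosed_subset ?_ inter_subset_left
    exact h.continuousOn_dist.preimage_isClosed_of_isClosed
      (h.isCompact.prod isCompact_Icc).isClosed isClosed_Ici
  have hu : ContinuousOn (fun p : 𝔼 × ℝ => u p.1 p.2)
      ((K ×ˢ Icc a b) ∩ (fun p : 𝔼 × ℝ => ‖p.1 - ξ p.2‖) ⁻¹' Ici r) := by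
    refine h.heat.1.mono ?_
    rintro ⟨y, s⟩ ⟨⟨hy, hs⟩, hd⟩
    refine h.mem y hy s hs fun heq => ?_
    have hd' : r ≤ ‖y - ξ s‖ := hd
    simp only [heq, sub_self, norm_zero] at hd'
    linarith
  obtain ⟨C, hC⟩ := hc.exists_bound_of_continuousOn hu
  refine ⟨max C 0, le_max_right _ _, fun s hs y hy => ?_⟩
  have hp : 0 ≤ ‖y - ξ s‖ ^ ((2 : ℝ) - N) := by positivity
  by_cases hd : ‖y - ξ s‖ < r
  · linarith [H s hs y hd, le_max_right C 0]
  · have := hC (y, s) ⟨⟨hy, hs⟩, not_lt.mp hd⟩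
    rw [norm_eq_abs] at this
    linarith [le_max_left C 0]

lemma IsSmallNear.stronglyMeasurable {u : 𝔼 → ℝ → ℝ} {ξ : ℝ → 𝔼} {S : Set (𝔼 × ℝ)}
    {K : Set 𝔼} {a b Λ : ℝ} (h : IsSmallNear u ξ S K a b Λ) :
    StronglyMeasurable ((K ×ˢ Icc a b).indicator fun p : 𝔼 × ℝ => u p.1 p.2) := by
  have hm : MeasurableSet ((K ×ˢ Icc a b) ∩ (fun p : 𝔼 × ℝ => ‖p.1 - ξ p.2‖) ⁻¹' {0}) :=
    (h.continuousOn_dist.preimage_isClosed_of_isClosed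
      (h.isCompact.prod isCompact_Icc).isClosed isClosed_singleton).measurableSet
  have hm' : MeasurableSet ((K ×ˢ Icc a b) \
      ((K ×ˢ Icc a b) ∩ (fun p : 𝔼 × ℝ => ‖p.1 - ξ p.2‖) ⁻¹' {0})) :=
    (h.isCompact.prod isCompact_Icc).isClosed.measurableSet.diff hm
  have heq : ((K ×ˢ Icc a b).indicator fun p : 𝔼 × ℝ => u p.1 p.2) =
      ((K ×ˢ Icc a b) \ ((K ×ˢ Icc a b) ∩ (fun p : 𝔼 × ℝ => ‖p.1 - ξ p.2‖) ⁻¹' {0})).indicator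
        fun p : 𝔼 × ℝ => u p.1 p.2 := by
    funext p
    by_cases hp : p ∈ K ×ˢ Icc a b
    · by_cases hd : p.1 = ξ p.2
      · simp [indicator, hp, hd, h.zero p.2 hp.2]
      · simp [indicator, hp, sub_eq_zero, hd]
    · simp [indicator, hp]
  classical
  rw [heq, ← piecewise_eq_indicator]
  refine Measurable.stronglyMeasurable ?_
  refine ContinuousOn.measurable_piecewise (g := fun _ => (0 : ℝ)) (f := fun p : 𝔼 × ℝ => u p.1 p.2)
    (h.heat.1.mono ?_) continuousOn_const hm'
  rintro ⟨y, s⟩ ⟨⟨hy, hs⟩, hd⟩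
  refine h.mem y hy s hs fun heq => hd ⟨⟨hy, hs⟩, ?_⟩
  simp [heq]

lemma IsSmallNear.integrableOn_slice {u : 𝔼 → ℝ → ℝ} {ξ : ℝ → 𝔼} {S : Set (𝔼 × ℝ)}
    {K : Set 𝔼} {a b Λ : ℝ} (h : IsSmallNear u ξ S K a b Λ) (hN : 1 ≤ N) :
    ∃ C : ℝ, ∀ s ∈ Icc a b, IntegrableOn (fun y => u y s) K ∧ ∫ y in K, |u y s| ≤ C := by
  obtain ⟨C₀, hC₀, hbd⟩ := h.exists_bound
  obtain ⟨C₁, hC₁, hint⟩ := exists_integral_norm_rpow_le hN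
  obtain ⟨R, hR⟩ := (h.isCompact.prod (isCompact_Icc (a := a) (b := b))).exists_bound_of_continuousOn
    h.continuousOn_dist
  set R' : ℝ := max R 0 + 1 with hR'
  have hR'0 : 0 ≤ R' := by positivity
  refine ⟨C₁ * R' ^ 2 + (volume : Measure 𝔼).real K * C₀, fun s hs => ?_⟩
  have hsub : K ⊆ ball (ξ s) R' := fun y hy => by
    have := hR (y, s) ⟨hy, hs⟩
    rw [norm_norm] at this
    rw [mem_ball_iff_norm]
    exact lt_of_le_of_lt (this.trans (le_max_left R 0)) (by simp [hR'])
  have hK : MeasurableSet K := h.isCompact.measurableSet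
  have hi1 : IntegrableOn (fun y => ‖y - ξ s‖ ^ ((2 : ℝ) - N)) K :=
    (integrableOn_norm_rpow hN R' (ξ s)).mono_set hsub
  have hi2 : IntegrableOn (fun _ : 𝔼 => C₀) K := continuousOn_const.integrableOn_compact h.isCompact
  have hms : AEStronglyMeasurable (fun y => u y s) (volume.restrict K) := by
    have h1 : StronglyMeasurable fun y =>
        (K ×ˢ Icc a b).indicator (fun p : 𝔼 × ℝ => u p.1 p.2) (y, s) :=
      h.stronglyMeasurable.comp_measurable (by fun_prop)
    refine h1.aestronglyMeasurable.congr ?_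
    filter_upwards [ae_restrict_mem hK] with y hy
    simp [indicator, hy, mem_Icc.mp hs]
  have hdom : ∀ᵐ y ∂volume.restrict K, ‖u y s‖ ≤ ‖y - ξ s‖ ^ ((2 : ℝ) - N) + C₀ := by
    filter_upwards [ae_restrict_mem hK] with y hy using hbd s hs y hy
  refine ⟨(hi1.add hi2).mono' hms hdom, ?_⟩
  calc ∫ y in K, |u y s| ≤ ∫ y in K, (‖y - ξ s‖ ^ ((2 : ℝ) - N) + C₀) :=
        integral_mono_ae ((hi1.add hi2).mono' hms hdom).abs (hi1.add hi2) hdom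
    _ = (∫ y in K, ‖y - ξ s‖ ^ ((2 : ℝ) - N)) + (volume : Measure 𝔼).real K * C₀ := by
        rw [integral_add hi1 hi2, setIntegral_const, smul_eq_mul]
    _ ≤ _ := by
        gcongr
        refine le_trans ?_ (hint R' hR'0 (ξ s))
        exact setIntegral_mono_set (integrableOn_norm_rpow hN R' (ξ s))
          (Eventually.of_forall fun y => by positivity) hsub.eventuallyLE

lemma IsSmallNear.integrableOn {u : 𝔼 → ℝ → ℝ} {ξ : ℝ → 𝔼} {S : Set (𝔼 × ℝ)}
    {K : Set 𝔼} {a b Λ : ℝ} (h : IsSmallNear u ξ S K a b Λ) (hN : 1 ≤ N) :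
    IntegrableOn (fun p : 𝔼 × ℝ => u p.1 p.2) (K ×ˢ Icc a b) := by
  obtain ⟨C, hC⟩ := h.integrableOn_slice hN
  have hK : MeasurableSet (K ×ˢ Icc a b) := h.isCompact.measurableSet.prod measurableSet_Icc
  have hm : AEStronglyMeasurable (fun p : 𝔼 × ℝ => u p.1 p.2)
      ((volume.restrict K).prod (volume.restrict (Icc a b))) := by
    refine h.stronglyMeasurable.aestronglyMeasurable.congr ?_
    rw [Measure.prod_restrict]
    filter_upwards [ae_restrict_mem hK] with p hp
    exact indicator_of_mem hp _
  rw [IntegrableOn, Measure.volume_eq_prod, ← Measure.prod_restrict, integrable_prod_iff' hm]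
  refine ⟨?_, ?_⟩
  · filter_upwards [ae_restrict_mem measurableSet_Icc] with s hs using (hC s hs).1
  · refine Integrable.mono' (g := fun _ => C) (continuousOn_const.integrableOn_Icc)
      hm.norm.prod_swap.integral_prod_right' ?_
    filter_upwards [ae_restrict_mem measurableSet_Icc] with s hs
    rw [norm_of_nonneg (integral_nonneg fun _ => norm_nonneg _)]
    exact (hC s hs).2

lemma abs_integral_sub_le {C : ℝ} (hN : 1 ≤ N) (hC : ∀ r : ℝ, 0 ≤ r → ∀ x₀ : 𝔼,
      ∫ y in ball x₀ r, ‖y - x₀‖ ^ ((2 : ℝ) - N) ≤ C * r ^ 2) {f g : 𝔼 → ℝ} (hf : Integrable f)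
    (hg : Integrable g) {A r : ℝ} (hA : 0 ≤ A) (hr : 0 ≤ r) {c : 𝔼}
    (h : ∀ y ∈ ball c r, |f y - g y| ≤ A * ‖y - c‖ ^ ((2 : ℝ) - N))
    (h' : ∀ y, y ∉ ball c r → f y = g y) :
    |(∫ y, f y) - ∫ y, g y| ≤ A * (C * r ^ 2) := by
  rw [← integral_sub hf hg, ← setIntegral_eq_integral_of_forall_compl_eq_zero (s := ball c r)
    fun y hy => sub_eq_zero.mpr (h' y hy), ← norm_eq_abs]
  calc ‖∫ y in ball c r, (f y - g y)‖ ≤ ∫ y in ball c r, A * ‖y - c‖ ^ ((2 : ℝ) - N) := by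
        refine norm_integral_le_of_norm_le ((integrableOn_norm_rpow hN r c).const_mul A) ?_
        filter_upwards [ae_restrict_mem measurableSet_ball] with y hy using h y hy
    _ ≤ _ := by
        rw [integral_const_mul]
        exact mul_le_mul_of_nonneg_left (hC r hr c) hA

lemma IsSmallNear.integrable_mul {u : 𝔼 → ℝ → ℝ} {ξ : ℝ → 𝔼} {S : Set (𝔼 × ℝ)}
    {K : Set 𝔼} {a b Λ : ℝ} (h : IsSmallNear u ξ S K a b Λ) (hN : 1 ≤ N) {ψ : 𝔼 → ℝ → ℝ} {s : ℝ}
    (hs : s ∈ Icc a b) (hψ : ContinuousOn (fun y => ψ y s) K) (h0 : ∀ y, y ∉ K → ψ y s = 0) :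
    Integrable (fun y => u y s * ψ y s) := by
  obtain ⟨C, hC⟩ := h.integrableOn_slice hN
  refine (integrableOn_iff_integrable_of_support_subset ?_).mp
    ((hC s hs).1.mul_continuousOn hψ h.isCompact)
  intro y hy
  by_contra hyK
  exact hy (by simp [h0 y hyK])

lemma IsSmallNear.integrableOn_mul {u : 𝔼 → ℝ → ℝ} {ξ : ℝ → 𝔼} {S : Set (𝔼 × ℝ)}
    {K : Set 𝔼} {a b Λ : ℝ} (h : IsSmallNear u ξ S K a b Λ) (hN : 1 ≤ N) {ψ : 𝔼 → ℝ → ℝ}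
    (hψ : ContinuousOn (fun p : 𝔼 × ℝ => ψ p.1 p.2) (univ ×ˢ Icc a b))
    (h0 : ∀ y, y ∉ K → ∀ s ∈ Icc a b, ψ y s = 0) :
    IntegrableOn (fun s => ∫ y, u y s * ψ y s) (Icc a b) ∧
    ∫ s in Icc a b, ∫ y, u y s * ψ y s = ∫ p in K ×ˢ Icc a b, u p.1 p.2 * ψ p.1 p.2 := by
  have h1 : IntegrableOn (fun p : 𝔼 × ℝ => u p.1 p.2 * ψ p.1 p.2) (K ×ˢ Icc a b) :=
    (h.integrableOn hN).mul_continuousOn (hψ.mono (prod_mono_left (subset_univ _)))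
      (h.isCompact.prod isCompact_Icc)
  rw [IntegrableOn, Measure.volume_eq_prod, ← Measure.prod_restrict] at h1
  have h2 : ∀ s ∈ Icc a b, ∫ y in K, u y s * ψ y s = ∫ y, u y s * ψ y s := fun s hs =>
    setIntegral_eq_integral_of_forall_compl_eq_zero fun y hy => by simp [h0 y hy s hs]
  refine ⟨h1.integral_prod_right.congr ?_, ?_⟩
  · filter_upwards [ae_restrict_mem measurableSet_Icc] with s hs using h2 s hs
  · rw [Measure.volume_eq_prod, ← Measure.prod_restrict, integral_prod_symm _ h1]
    exact (setIntegral_congr_fun measurableSet_Icc h2).symm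

set_option maxHeartbeats 1000000 in
/-- The weak formulation of the heat equation holds across the singular curve. -/
lemma IsSmallNear.integral_test {u : 𝔼 → ℝ → ℝ} {ξ : ℝ → 𝔼} {S : Set (𝔼 × ℝ)}
    {K : Set 𝔼} {a b Λ : ℝ} (h : IsSmallNear u ξ S K a b Λ) (hN : 1 ≤ N) (hab : a ≤ b)
    {φ φt : 𝔼 → ℝ → ℝ} {φi φii : Fin N → 𝔼 → ℝ → ℝ} (hφ : IsTest K (Icc a b) φ φt φi φii) :
    ∫ s in a..b, ∫ y, u y s * (φt y s + ∑ i, φii i y s) =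
      (∫ y, u y b * φ y b) - ∫ y, u y a * φ y a := by
  obtain ⟨M, hM, hcut⟩ := exists_cutoff (N := N)
  obtain ⟨C, hC0, hC⟩ := exists_integral_norm_rpow_le hN
  have hKI : IsCompact (K ×ˢ Icc a b) := h.isCompact.prod isCompact_Icc
  have hsub : K ×ˢ Icc a b ⊆ univ ×ˢ Icc a b := prod_mono_left (subset_univ _)
  have hH : ContinuousOn (fun p : 𝔼 × ℝ => φt p.1 p.2 + ∑ i, φii i p.1 p.2) (univ ×ˢ Icc a b) :=
    hφ.cont_t.add (continuousOn_finsetSum _ fun i _ => hφ.cont_ii i)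
  have hH0 : ∀ y, y ∉ K → ∀ s ∈ Icc a b, φt y s + ∑ i, φii i y s = 0 := by
    intro y hy s hs
    obtain ⟨-, h2, -, h4⟩ := hφ.zero y hy s hs
    simp [h2, h4]
  obtain ⟨P, hP0, hPφ, hPi, hPH⟩ : ∃ P : ℝ, 0 ≤ P ∧ (∀ y, ∀ s ∈ Icc a b, |φ y s| ≤ P) ∧
      (∀ i y, ∀ s ∈ Icc a b, |φi i y s| ≤ P) ∧
      ∀ y, ∀ s ∈ Icc a b, |φt y s + ∑ i, φii i y s| ≤ P := by
    obtain ⟨P1, h1⟩ := hKI.exists_bound_of_continuousOn (hφ.cont.mono hsub)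
    obtain ⟨P2, h2⟩ := hKI.exists_bound_of_continuousOn (hH.mono hsub)
    have h3 := fun i => hKI.exists_bound_of_continuousOn ((hφ.cont_i i).mono hsub)
    choose P3 h3 using h3
    have e1 := le_abs_self P1
    have e2 := le_abs_self P2
    have e3 : 0 ≤ ∑ i, |P3 i| := by positivity
    have e4 := abs_nonneg P1
    have e5 := abs_nonneg P2
    refine ⟨|P1| + |P2| + ∑ i, |P3 i|, by positivity, fun y s hs => ?_, fun i y s hs => ?_,
      fun y s hs => ?_⟩
    · by_cases hy : y ∈ K
      · have := h1 (y, s) ⟨hy, hs⟩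
        rw [norm_eq_abs] at this
        linarith
      · rw [(hφ.zero y hy s hs).1, abs_zero]
        positivity
    · by_cases hy : y ∈ K
      · have := h3 i (y, s) ⟨hy, hs⟩
        rw [norm_eq_abs] at this
        have e6 := Finset.single_le_sum (f := fun j => |P3 j|) (fun j _ => abs_nonneg _)
          (Finset.mem_univ i)
        have e7 := le_abs_self (P3 i)
        linarith [e6, e7]
      · rw [(hφ.zero y hy s hs).2.2.1 i, abs_zero]
        positivity
    · by_cases hy : y ∈ K
      · have := h2 (y, s) ⟨hy, hs⟩
        rw [norm_eq_abs] at this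
        linarith
      · rw [hH0 y hy s hs, abs_zero]
        positivity
  set J : ℝ → ℝ := fun s => ∫ y, u y s * (φt y s + ∑ i, φii i y s) with hJ
  have hJint : IntegrableOn J (Icc a b) := (h.integrableOn_mul hN hH hH0).1
  have hJI : ∀ s ∈ Icc a b, ∀ s' ∈ Icc a b, IntervalIntegrable J volume s s' :=
    fun s hs s' hs' => (hJint.mono_set (uIcc_subset_Icc hs hs')).intervalIntegrable
  set Q : ℝ := 16 * P * C * (2 * (Λ + 1) ^ 2 + 1 + 3 * N * M) with hQ
  have hΛ := h.nonneg
  have hQ0 : 0 ≤ Q := by positivity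
  have key := eq_of_forall_abs_sub_le
    (f := fun s => (∫ y, u y s * φ y s) - ∫ σ in a..s, J σ) hab ?_
  · simp only [intervalIntegral.integral_same] at key
    linarith
  intro ε hε
  obtain ⟨r, hr, hsm⟩ := h.small (ε / (Q + 1)) (by positivity)
  set ε' := ε / (Q + 1) with hε'
  have hε'0 : 0 < ε' := by positivity
  refine ⟨(min (r / 4) 1 / (Λ + 1)) ^ 2, by positivity, fun s hs s' hs' hss hδ => ?_⟩
  set ρ : ℝ := (Λ + 1) * √(s' - s) with hρ
  have hd0 : 0 < s' - s := sub_pos.mpr hss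
  have hsq : 0 < √(s' - s) := Real.sqrt_pos.mpr hd0
  have hρ0 : 0 < ρ := by positivity
  have hρlt : ρ < min (r / 4) 1 := by
    have h1 : √(s' - s) < min (r / 4) 1 / (Λ + 1) := by
      rw [Real.sqrt_lt' (by positivity)]
      linarith
    rw [lt_div_iff₀ (by positivity)] at h1
    rw [hρ, mul_comm]
    exact h1
  have hρr : 4 * ρ < r := by linarith [hρlt.trans_le (min_le_left _ _)]
  have hρ1 : ρ < 1 := hρlt.trans_le (min_le_right _ _)
  have hρsq : ρ ^ 2 = (Λ + 1) ^ 2 * (s' - s) := by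
    rw [hρ, mul_pow, Real.sq_sqrt hd0.le]
  obtain ⟨η, hη, hη0, hηb, hη1, hηd⟩ := hcut (ξ s) ρ hρ0
  have hI : Icc s s' ⊆ Icc a b := Icc_subset_Icc hs.1 hs'.2
  have hcurve : ∀ σ ∈ Icc s s', ‖ξ s - ξ σ‖ < ρ := by
    intro σ hσ
    refine (h.holder s hs σ (hI hσ)).trans_lt ?_
    have h1 : √|s - σ| ≤ √(s' - s) := by
      apply Real.sqrt_le_sqrt
      rw [abs_sub_comm, abs_of_nonneg (by linarith [hσ.1])]
      linarith [hσ.2]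
    have h2 := mul_le_mul_of_nonneg_left h1 hΛ
    rw [hρ, add_mul, one_mul]
    linarith
  have hψ := (hφ.mono hI).mul hη isOpen_ball hη0
  have hK' : IsCompact (K \ ball (ξ s) (2 * ρ)) := h.isCompact.diff isOpen_ball
  have hK'S : (K \ ball (ξ s) (2 * ρ)) ×ˢ Icc s s' ⊆ S := by
    rintro ⟨y, σ⟩ ⟨⟨hy, hyb⟩, hσ⟩
    refine h.mem y hy σ (hI hσ) fun heq => hyb ?_
    have h3 := hcurve σ hσ
    rw [norm_sub_rev] at h3
    rw [mem_ball_iff_norm, show y = ξ σ from heq]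
    linarith
  obtain ⟨hψint, hψeq⟩ := h.heat.integral_test h.isOpen hK' hss.le hK'S hψ
  have hfar : ∀ σ ∈ Icc s s', ∀ y, y ∉ ball (ξ σ) (4 * ρ) → y ∉ closedBall (ξ s) (3 * ρ) := by
    intro σ hσ y hy hy'
    refine hy ?_
    rw [mem_closedBall_iff_norm] at hy'
    rw [mem_ball_iff_norm]
    have h1 := hcurve σ hσ
    have h2 := norm_sub_le_norm_sub_add_norm_sub y (ξ s) (ξ σ)
    linarith
  have hends : ∀ σ ∈ Icc s s', |(∫ y, u y σ * (η y * φ y σ)) - ∫ y, u y σ * φ y σ| ≤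
      ε' * P * (C * (4 * ρ) ^ 2) := by
    intro σ hσ
    have hc := (continuousOn_slice hφ.cont (hI hσ)).mono (subset_univ K)
    refine abs_integral_sub_le hN hC
      (h.integrable_mul hN (ψ := fun y s => η y * φ y s) (hI hσ) (hη.continuous.continuousOn.mul hc)
        fun y hy => by simp [(hφ.zero y hy σ (hI hσ)).1])
      (h.integrable_mul hN (hI hσ) hc fun y hy => (hφ.zero y hy σ (hI hσ)).1)
      (by positivity) (by positivity) (c := ξ σ) (fun y hy => ?_) fun y hy => ?_
    · have e1 := hsm σ (hI hσ) y ((mem_ball_iff_norm.mp hy).trans hρr)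
      rw [show u y σ * (η y * φ y σ) - u y σ * φ y σ = u y σ * ((η y - 1) * φ y σ) by ring,
        abs_mul, abs_mul]
      have e2 : |η y - 1| * |φ y σ| ≤ 1 * P :=
        mul_le_mul (hηb y) (hPφ y σ (hI hσ)) (abs_nonneg _) zero_le_one
      calc _ ≤ (ε' * ‖y - ξ σ‖ ^ ((2 : ℝ) - N)) * (1 * P) :=
            mul_le_mul e1 e2 (by positivity) (by positivity)
        _ = _ := by ring
    · rw [hη1 y (hfar σ hσ y hy), one_mul]
  have hmid : ∀ σ ∈ Icc s s', |(∫ y, u y σ * (η y * φt y σ +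
      ∑ i, (iteratedDeriv 2 (fun h : ℝ => η (y + h • 𝐞 i)) 0 * φ y σ +
        2 * deriv (fun h : ℝ => η (y + h • 𝐞 i)) 0 * φi i y σ + η y * φii i y σ))) - J σ| ≤
      16 * ε' * P * C * (1 + 3 * N * M) := by
    intro σ hσ
    have hσ' := hI hσ
    have hA : ε' * (P * (1 + 3 * N * M) / ρ ^ 2) * (C * (4 * ρ) ^ 2) =
      16 * ε' * P * C * (1 + 3 * N * M) := by
      field_simp
      ring
    rw [← hA]
    have hcψ : ContinuousOn (fun p : 𝔼 × ℝ => η p.1 * φt p.1 p.2 +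
      ∑ i, (iteratedDeriv 2 (fun h : ℝ => η (p.1 + h • 𝐞 i)) 0 * φ p.1 p.2 +
        2 * deriv (fun h : ℝ => η (p.1 + h • 𝐞 i)) 0 * φi i p.1 p.2 + η p.1 * φii i p.1 p.2))
        (univ ×ˢ Icc s s') :=
      hψ.cont_t.add (continuousOn_finsetSum _ fun i _ => hψ.cont_ii i)
    refine abs_integral_sub_le hN hC
      (h.integrable_mul hN (ψ := fun y s => η y * φt y s +
        ∑ i, (iteratedDeriv 2 (fun h : ℝ => η (y + h • 𝐞 i)) 0 * φ y s +
        2 * deriv (fun h : ℝ => η (y + h • 𝐞 i)) 0 * φi i y s + η y * φii i y s)) hσ'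
        ((hcψ.comp (f := fun y => (y, σ)) (by fun_prop) fun _ _ => ⟨mem_univ _, hσ⟩).mono
          (subset_univ K)) fun y hy => ?_)
      (h.integrable_mul hN (ψ := fun y s => φt y s + ∑ i, φii i y s) hσ'
        ((hH.comp (f := fun y => (y, σ)) (by fun_prop) fun _ _ => ⟨mem_univ _, hσ'⟩).mono
          (subset_univ K)) fun y hy => hH0 y hy σ hσ')
      (by positivity) (by positivity) (c := ξ σ) (fun y hy => ?_) fun y hy => ?_
    · obtain ⟨z1, z2, z3, z4⟩ := hφ.zero y hy σ hσ'
      simp [z1, z2, z3, z4]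
    · have e1 := hsm σ hσ' y ((mem_ball_iff_norm.mp hy).trans hρr)
      rw [← mul_sub, abs_mul]
      have e0 : (η y * φt y σ +
          ∑ i, (iteratedDeriv 2 (fun h : ℝ => η (y + h • 𝐞 i)) 0 * φ y σ +
          2 * deriv (fun h : ℝ => η (y + h • 𝐞 i)) 0 * φi i y σ + η y * φii i y σ)) -
          (φt y σ + ∑ i, φii i y σ) = (η y - 1) * (φt y σ + ∑ i, φii i y σ) +
          ∑ i, (iteratedDeriv 2 (fun h : ℝ => η (y + h • 𝐞 i)) 0 * φ y σ +
          2 * deriv (fun h : ℝ => η (y + h • 𝐞 i)) 0 * φi i y σ) := by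
        rw [Finset.sum_add_distrib, ← Finset.mul_sum]
        ring
      have e2 : |(η y - 1) * (φt y σ + ∑ i, φii i y σ)| ≤ P / ρ ^ 2 := by
        rw [abs_mul]
        calc _ ≤ 1 * P := mul_le_mul (hηb y) (hPH y σ hσ') (abs_nonneg _) zero_le_one
          _ ≤ _ := by
            rw [one_mul, le_div_iff₀ (by positivity)]
            exact mul_le_of_le_one_right hP0 (by nlinarith)
      have e3 : ∀ i : Fin N, |iteratedDeriv 2 (fun h : ℝ => η (y + h • 𝐞 i)) 0 * φ y σ +
          2 * deriv (fun h : ℝ => η (y + h • 𝐞 i)) 0 * φi i y σ| ≤ 3 * M * P / ρ ^ 2 := by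
        intro i
        obtain ⟨d1, d2⟩ := hηd i y
        have d1' : |deriv (fun h : ℝ => η (y + h • 𝐞 i)) 0| ≤ M / ρ ^ 2 := by
          refine d1.trans (div_le_div_of_nonneg_left hM.le (by positivity) (by nlinarith))
        refine (abs_add_le _ _).trans ?_
        rw [abs_mul, abs_mul, abs_mul, abs_two]
        have f1 := mul_le_mul d2 (hPφ y σ hσ') (abs_nonneg _) (by positivity)
        have f2 := mul_le_mul d1' (hPi i y σ hσ') (abs_nonneg _) (by positivity)
        calc _ ≤ M / ρ ^ 2 * P + 2 * (M / ρ ^ 2 * P) := by linarith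
          _ = _ := by ring
      have e4 : |∑ i, (iteratedDeriv 2 (fun h : ℝ => η (y + h • 𝐞 i)) 0 * φ y σ +
          2 * deriv (fun h : ℝ => η (y + h • 𝐞 i)) 0 * φi i y σ)| ≤ N * (3 * M * P / ρ ^ 2) := by
        refine (Finset.abs_sum_le_sum_abs _ _).trans ((Finset.sum_le_sum fun i _ => e3 i).trans ?_)
        simp
      rw [e0]
      calc _ ≤ (ε' * ‖y - ξ σ‖ ^ ((2 : ℝ) - N)) * (P / ρ ^ 2 + N * (3 * M * P / ρ ^ 2)) :=
            mul_le_mul e1 ((abs_add_le _ _).trans (add_le_add e2 e4)) (by positivity)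
              (by positivity)
        _ = _ := by ring
    · have hy' := hfar σ hσ y hy
      have hev : η =ᶠ[𝓝 y] fun _ => 1 := by
        filter_upwards [isClosed_closedBall.isOpen_compl.mem_nhds hy'] with z hz using hη1 z hz
      have hd := fun i : Fin N => lineDerivs_congr hev (𝐞 i)
      simp [fun i => (hd i).1, fun i => (hd i).2, hη1 y hy', iteratedDeriv_const]
  have hsplit : (∫ σ in a..s', J σ) - ∫ σ in a..s, J σ = ∫ σ in s..s', J σ :=
    intervalIntegral.integral_interval_sub_left (hJI a (left_mem_Icc.mpr hab) s' hs')
      (hJI a (left_mem_Icc.mpr hab) s hs)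
  have hint := intervalIntegral.norm_integral_le_of_norm_le_const (a := s) (b := s')
    (C := 16 * ε' * P * C * (1 + 3 * N * M)) (f := fun σ => (∫ y, u y σ * (η y * φt y σ +
      ∑ i, (iteratedDeriv 2 (fun h : ℝ => η (y + h • 𝐞 i)) 0 * φ y σ +
        2 * deriv (fun h : ℝ => η (y + h • 𝐞 i)) 0 * φi i y σ + η y * φii i y σ))) - J σ)
    fun σ hσ => hmid σ (uIcc_of_le hss.le ▸ uIoc_subset_uIcc hσ)
  rw [intervalIntegral.integral_sub hψint (hJI s hs s' hs'), hψeq, abs_of_pos hd0, norm_eq_abs]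
    at hint
  have h1 := hends s (left_mem_Icc.mpr hss.le)
  have h2 := hends s' (right_mem_Icc.mpr hss.le)
  have hfin : ε' * P * (C * (4 * ρ) ^ 2) + ε' * P * (C * (4 * ρ) ^ 2) +
      16 * ε' * P * C * (1 + 3 * N * M) * (s' - s) ≤ ε * (s' - s) := by
    have : ε' * P * (C * (4 * ρ) ^ 2) + ε' * P * (C * (4 * ρ) ^ 2) +
      16 * ε' * P * C * (1 + 3 * N * M) * (s' - s) = ε' * Q * (s' - s) := by
      rw [mul_pow, hρsq, hQ]
      ring
    rw [this]
    refine mul_le_mul_of_nonneg_right ?_ hd0.le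
    rw [hε', div_mul_eq_mul_div, div_le_iff₀ (by positivity)]
    nlinarith
  rw [abs_le] at h1 h2 hint ⊢
  constructor <;> linarith [h1.1, h1.2, h2.1, h2.2, hint.1, hint.2]

/-- The function `σ ↦ σ ^ (-c) * exp (-1 / σ)`, extended by zero to `σ ≤ 0`. -/
def rpowMulExp (c σ : ℝ) : ℝ := if 0 < σ then σ ^ (-c) * exp (-σ⁻¹) else 0

lemma tendsto_rpowMulExp_zero (c : ℝ) : Tendsto (rpowMulExp c) (𝓝 0) (𝓝 0) := by
  have h1 : Tendsto (fun σ : ℝ => σ ^ (-c) * exp (-σ⁻¹)) (𝓝[>] 0) (𝓝 0) := by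
    have := (tendsto_rpow_mul_exp_neg_mul_atTop_nhds_zero c 1 one_pos).comp
      tendsto_inv_nhdsGT_zero
    refine this.congr' ?_
    filter_upwards [self_mem_nhdsWithin] with σ hσ
    have hσ' : (0 : ℝ) < σ := hσ
    simp [inv_rpow hσ'.le, rpow_neg hσ'.le]
  have h2 : Tendsto (rpowMulExp c) (𝓝[>] 0) (𝓝 0) := by
    refine h1.congr' ?_
    filter_upwards [self_mem_nhdsWithin] with σ hσ
    exact (if_pos hσ).symm
  have h3 : Tendsto (rpowMulExp c) (𝓝[≤] 0) (𝓝 0) := by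
    refine tendsto_const_nhds.congr' ?_
    filter_upwards [self_mem_nhdsWithin] with σ hσ
    exact (if_neg (not_lt.mpr hσ)).symm
  have h4 := h3.sup h2
  rwa [nhdsLE_sup_nhdsGT] at h4

lemma hasDerivAt_rpowMulExp (c σ : ℝ) :
    HasDerivAt (rpowMulExp c) (-c * rpowMulExp (c + 1) σ + rpowMulExp (c + 2) σ) σ := by
  rcases lt_trichotomy σ 0 with h | h | h
  · have hev : rpowMulExp c =ᶠ[𝓝 σ] fun _ => 0 := by
      filter_upwards [eventually_lt_nhds h] with τ hτ
      exact if_neg (not_lt.mpr hτ.le)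
    refine ((hasDerivAt_const σ (0 : ℝ)).congr_of_eventuallyEq hev).congr_deriv ?_
    simp [rpowMulExp, not_lt.mpr h.le]
  · subst h
    have h0 : ∀ c, rpowMulExp c 0 = 0 := fun c => if_neg (lt_irrefl _)
    rw [h0, h0, hasDerivAt_iff_tendsto_slope]
    simp only [mul_zero, add_zero]
    refine ((tendsto_rpowMulExp_zero (c + 1)).mono_left nhdsWithin_le_nhds).congr' ?_
    filter_upwards [self_mem_nhdsWithin] with τ hτ
    rw [slope_def_field, h0, sub_zero, sub_zero]
    unfold rpowMulExp
    split_ifs with hp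
    · rw [neg_add, rpow_add hp, rpow_neg_one]
      field_simp
    · simp
  · have hev : rpowMulExp c =ᶠ[𝓝 σ] fun τ => τ ^ (-c) * exp (-τ⁻¹) := by
      filter_upwards [eventually_gt_nhds h] with τ hτ
      exact if_pos hτ
    have h1 : HasDerivAt (fun τ : ℝ => τ ^ (-c)) (-c * σ ^ (-c - 1)) σ :=
      hasDerivAt_rpow_const (Or.inl h.ne')
    have h2 : HasDerivAt (fun τ : ℝ => exp (-τ⁻¹)) (exp (-σ⁻¹) * -(-(σ ^ 2)⁻¹)) σ :=
      ((hasDerivAt_inv h.ne').neg).exp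
    refine ((h1.mul h2).congr_of_eventuallyEq hev).congr_deriv ?_
    simp only [rpowMulExp, if_pos h]
    rw [show -c - 1 = -(c + 1) by ring, show -(c + 2) = -c + (-2 : ℝ) by ring, rpow_add h,
      rpow_neg h.le 2, rpow_two]
    ring

lemma contDiff_rpowMulExp (n : ℕ) (c : ℝ) : ContDiff ℝ n (rpowMulExp c) := by
  induction n generalizing c with
  | zero =>
    rw [Nat.cast_zero, contDiff_zero, continuous_iff_continuousAt]
    exact fun σ => (hasDerivAt_rpowMulExp c σ).continuousAt
  | succ n ih =>
    rw [Nat.cast_succ, contDiff_succ_iff_deriv]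
    refine ⟨fun σ => (hasDerivAt_rpowMulExp c σ).differentiableAt, by simp, ?_⟩
    rw [funext fun σ => (hasDerivAt_rpowMulExp c σ).deriv]
    exact (contDiff_const.mul (ih _)).add (ih _)

/-- The (unnormalised) heat kernel. -/
def heatKernel (p : 𝔼 × ℝ) : ℝ :=
  if 0 < p.2 then p.2 ^ (-((N : ℝ) / 2)) * exp (-(‖p.1‖ ^ 2 / (4 * p.2))) else 0

lemma heatKernel_of_pos (z : 𝔼) {τ : ℝ} (hτ : 0 < τ) :
    heatKernel (z, τ) = τ ^ (-((N : ℝ) / 2)) * exp (-(‖z‖ ^ 2 / (4 * τ))) := if_pos hτ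

lemma heatKernel_of_nonpos {p : 𝔼 × ℝ} (hp : p.2 ≤ 0) : heatKernel p = 0 := if_neg (not_lt.mpr hp)

lemma heatKernel_nonneg (p : 𝔼 × ℝ) : 0 ≤ heatKernel p := by
  unfold heatKernel
  split_ifs with h <;> positivity

lemma contDiffAt_heatKernel (n : ℕ) {p : 𝔼 × ℝ} (hp : p ≠ 0) :
    ContDiffAt ℝ n (heatKernel (N := N)) p := by
  rcases lt_trichotomy p.2 0 with h | h | h
  · have hev : heatKernel =ᶠ[𝓝 p] fun _ => 0 := by
      filter_upwards [(continuous_snd.tendsto p).eventually (eventually_lt_nhds h)] with q hq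
      exact heatKernel_of_nonpos (le_of_lt hq)
    exact contDiffAt_const.congr_of_eventuallyEq hev
  · have hz : p.1 ≠ 0 := fun h0 => hp (Prod.ext h0 h)
    have hev : heatKernel =ᶠ[𝓝 p] fun q => (‖q.1‖ ^ 2 / 4) ^ (-((N : ℝ) / 2)) *
        rpowMulExp ((N : ℝ) / 2) (4 * q.2 / ‖q.1‖ ^ 2) := by
      filter_upwards [(continuous_fst.tendsto p).eventually (isOpen_ne.mem_nhds hz)] with q hq
      have hq' : 0 < ‖q.1‖ := norm_pos_iff.mpr hq
      by_cases hτ : 0 < q.2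
      · have hσ : 0 < 4 * q.2 / ‖q.1‖ ^ 2 := by positivity
        rw [heatKernel, if_pos hτ, rpowMulExp, if_pos hσ, ← mul_assoc,
          ← mul_rpow (by positivity) hσ.le, inv_div]
        congr 2
        field_simp
      · have hσ : ¬ 0 < 4 * q.2 / ‖q.1‖ ^ 2 := by
          rw [not_lt] at hτ ⊢
          exact div_nonpos_of_nonpos_of_nonneg (by linarith) (by positivity)
        rw [heatKernel, if_neg hτ, rpowMulExp, if_neg hσ, mul_zero]
    refine ContDiffAt.congr_of_eventuallyEq ?_ hev
    have hn : ContDiffAt ℝ n (fun q : 𝔼 × ℝ => ‖q.1‖ ^ 2) p :=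
      (contDiff_fst.norm_sq ℝ).contDiffAt
    have hn0 : ‖p.1‖ ^ 2 ≠ 0 := by positivity
    refine ((hn.div_const 4).rpow_const_of_ne (by positivity)).mul ?_
    exact (contDiff_rpowMulExp n _).contDiffAt.comp p
      ((contDiffAt_const.mul contDiffAt_snd).div hn hn0)
  · have hev : heatKernel =ᶠ[𝓝 p] fun q => q.2 ^ (-((N : ℝ) / 2)) *
        exp (-(‖q.1‖ ^ 2 / (4 * q.2))) := by
      filter_upwards [(continuous_snd.tendsto p).eventually (eventually_gt_nhds h)] with q hq
      exact if_pos hq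
    refine ContDiffAt.congr_of_eventuallyEq ?_ hev
    have hn : ContDiffAt ℝ n (fun q : 𝔼 × ℝ => ‖q.1‖ ^ 2) p :=
      (contDiff_fst.norm_sq ℝ).contDiffAt
    exact (contDiffAt_snd.rpow_const_of_ne h.ne').mul
      ((hn.div (contDiffAt_const.mul contDiffAt_snd) (by positivity)).neg.exp)

lemma hasDerivAt_heatKernel_time (z : 𝔼) {τ : ℝ} (hτ : 0 < τ) :
    HasDerivAt (fun τ => heatKernel (z, τ))
      ((-(N / (2 * τ)) + ‖z‖ ^ 2 / (4 * τ ^ 2)) * heatKernel (z, τ)) τ := by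
  have hev : (fun τ => heatKernel (z, τ)) =ᶠ[𝓝 τ] fun τ => τ ^ (-((N : ℝ) / 2)) *
      exp (-(‖z‖ ^ 2 / (4 * τ))) := by
    filter_upwards [eventually_gt_nhds hτ] with q hq using heatKernel_of_pos z hq
  have h1 : HasDerivAt (fun τ : ℝ => τ ^ (-((N : ℝ) / 2))) _ τ :=
    hasDerivAt_rpow_const (Or.inl hτ.ne')
  have h2 : HasDerivAt (fun τ : ℝ => exp (-(‖z‖ ^ 2 / (4 * τ))))
      (exp (-(‖z‖ ^ 2 / (4 * τ))) * (‖z‖ ^ 2 / (4 * τ ^ 2))) τ := by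
    refine (((hasDerivAt_const τ (‖z‖ ^ 2)).div ((hasDerivAt_id τ).const_mul 4)
      (by simp [hτ.ne'])).neg).exp.congr_deriv ?_
    simp
    field_simp
  refine ((h1.mul h2).congr_of_eventuallyEq hev).congr_deriv ?_
  rw [heatKernel_of_pos z hτ, rpow_sub hτ, rpow_one]
  field_simp

lemma hasLineDerivAt_heatKernel (i : Fin N) (z : 𝔼) {τ : ℝ} (hτ : 0 < τ) :
    HasLineDerivAt ℝ (fun z => heatKernel (z, τ)) (-(z i / (2 * τ)) * heatKernel (z, τ)) z (𝐞 i) ∧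
    HasLineDerivAt ℝ (fun z : 𝔼 => -(z i / (2 * τ)) * heatKernel (z, τ))
      ((-(1 / (2 * τ)) + z i ^ 2 / (4 * τ ^ 2)) * heatKernel (z, τ)) z (𝐞 i) := by
  have h1 : HasLineDerivAt ℝ (fun z => heatKernel (z, τ))
      (-(z i / (2 * τ)) * heatKernel (z, τ)) z (𝐞 i) := by
    unfold HasLineDerivAt
    have hn : ∀ h : ℝ, ‖z + h • 𝐞 i‖ ^ 2 = ‖z‖ ^ 2 + 2 * z i * h + h ^ 2 := fun h => by
      simpa using norm_add_smul_single_sub_sq z 0 i h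
    simp only [heatKernel_of_pos _ hτ, hn]
    have hd : HasDerivAt (fun h : ℝ => ‖z‖ ^ 2 + 2 * z i * h + h ^ 2) (2 * z i) 0 := by
      have := (((hasDerivAt_id (0 : ℝ)).const_mul (2 * z i)).const_add (‖z‖ ^ 2)).add
        ((hasDerivAt_id (0 : ℝ)).pow 2)
      exact this.congr_deriv (by simp)
    refine (((hd.div_const (4 * τ)).neg.exp).const_mul _).congr_deriv ?_
    simp
    field_simp
    ring
  refine ⟨h1, ?_⟩
  have h2 : HasLineDerivAt ℝ (fun z : 𝔼 => -(z i / (2 * τ))) (-(1 / (2 * τ))) z (𝐞 i) := by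
    unfold HasLineDerivAt
    have := (((hasDerivAt_id (0 : ℝ)).const_add (z i)).div_const (2 * τ)).neg
    refine this.congr_of_eventuallyEq (Eventually.of_forall fun h => ?_)
    simp
  have := HasDerivAt.mul h2 h1
  refine this.congr_deriv ?_
  simp only [zero_smul, add_zero]
  field_simp
  ring

lemma fderiv_heatKernel_of_pos (i : Fin N) (z : 𝔼) {τ : ℝ} (hτ : 0 < τ) :
    fderiv ℝ heatKernel (z, τ) (𝐞 i, 0) = -(z i / (2 * τ)) * heatKernel (z, τ) := by
  have hne : ((z, τ) : 𝔼 × ℝ) ≠ 0 := fun h => hτ.ne' (congrArg Prod.snd h)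
  have h1 := (((contDiffAt_heatKernel 1 hne).differentiableAt (by simp)).hasFDerivAt.hasLineDerivAt
    ((𝐞 i), (0 : ℝ)))
  unfold HasLineDerivAt at h1
  simp only [Prod.smul_mk, smul_zero, Prod.mk_add_mk, add_zero] at h1
  exact h1.unique (hasLineDerivAt_heatKernel i z hτ).1

lemma fderiv_heatKernel_of_nonpos {p : 𝔼 × ℝ} (hp : p.2 ≤ 0) : fderiv ℝ heatKernel p = 0 := by
  refine IsLocalMin.fderiv_eq_zero (Eventually.of_forall fun q => ?_)
  rw [heatKernel_of_nonpos hp]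
  exact heatKernel_nonneg q

lemma HasLineDerivAt.comp_const_sub {F : 𝔼 → ℝ} {F' : ℝ} {x y v : 𝔼}
    (h : HasLineDerivAt ℝ F F' (x - y) v) : HasLineDerivAt ℝ (fun y => F (x - y)) (-F') y v := by
  unfold HasLineDerivAt at h ⊢
  have h1 : HasDerivAt (fun t : ℝ => F (x - y + t • v)) F' (-0) := by simpa using h
  have h2 := h1.comp (0 : ℝ) (hasDerivAt_neg (0 : ℝ))
  refine (h2.congr_of_eventuallyEq (Eventually.of_forall fun t => ?_)).congr_deriv (by simp)
  simp only [Function.comp_apply]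
  congr 1
  module

lemma isTest_heatKernel {β : ℝ → ℝ} (hβ : ContDiff ℝ 1 β) (x : 𝔼) {t : ℝ} {I : Set ℝ}
    (hI : ∀ s ∈ I, s < t) :
    IsTest univ I (fun y s => β s * heatKernel (x - y, t - s))
      (fun y s => deriv β s * heatKernel (x - y, t - s) -
        β s * ((-(N / (2 * (t - s))) + ‖x - y‖ ^ 2 / (4 * (t - s) ^ 2)) *
          heatKernel (x - y, t - s)))
      (fun i y s => β s * ((x - y) i / (2 * (t - s)) * heatKernel (x - y, t - s)))
      (fun i y s => β s * ((-(1 / (2 * (t - s))) + (x - y) i ^ 2 / (4 * (t - s) ^ 2)) *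
        heatKernel (x - y, t - s))) := by
  have hG : ContinuousOn (fun p : 𝔼 × ℝ => heatKernel (x - p.1, t - p.2)) (univ ×ˢ I) := by
    intro p hp
    have hne : ((x - p.1, t - p.2) : 𝔼 × ℝ) ≠ 0 :=
      fun h => (sub_pos.mpr (hI _ hp.2)).ne' (congrArg Prod.snd h)
    have h1 : ContinuousAt (fun p : 𝔼 × ℝ => ((x - p.1, t - p.2) : 𝔼 × ℝ)) p := by fun_prop
    exact (ContinuousAt.comp (g := heatKernel)
      (f := fun p : 𝔼 × ℝ => ((x - p.1, t - p.2) : 𝔼 × ℝ)) (contDiffAt_heatKernel 0 hne).continuousAt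
      h1).continuousWithinAt
  have hτ : ContinuousOn (fun p : 𝔼 × ℝ => t - p.2) (univ ×ˢ I) := by fun_prop
  have hτ0 : ∀ p ∈ (univ : Set 𝔼) ×ˢ I, t - p.2 ≠ 0 := fun p hp => (sub_pos.mpr (hI _ hp.2)).ne'
  have hβc : ContinuousOn (fun p : 𝔼 × ℝ => β p.2) (univ ×ˢ I) :=
    (hβ.continuous.comp continuous_snd).continuousOn
  have hβd : ContinuousOn (fun p : 𝔼 × ℝ => deriv β p.2) (univ ×ˢ I) :=
    ((hβ.continuous_deriv le_rfl).comp continuous_snd).continuousOn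
  have hz : ∀ i, ContinuousOn (fun p : 𝔼 × ℝ => (x - p.1) i) (univ ×ˢ I) := fun i => by
    have : Continuous fun p : 𝔼 × ℝ => (x - p.1) i := by fun_prop
    exact this.continuousOn
  have hn : ContinuousOn (fun p : 𝔼 × ℝ => ‖x - p.1‖ ^ 2) (univ ×ˢ I) := by fun_prop
  have h2 : ∀ p ∈ (univ : Set 𝔼) ×ˢ I, 2 * (t - p.2) ≠ 0 := fun p hp =>
    mul_ne_zero two_ne_zero (hτ0 p hp)
  have h4 : ∀ p ∈ (univ : Set 𝔼) ×ˢ I, 4 * (t - p.2) ^ 2 ≠ 0 := fun p hp =>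
    mul_ne_zero four_ne_zero (pow_ne_zero 2 (hτ0 p hp))
  have hτ2 := (continuousOn_const (c := (2 : ℝ))).mul hτ
  have hτ4 := (continuousOn_const (c := (4 : ℝ))).mul (hτ.pow 2)
  refine ⟨hβc.mul hG, (hβd.mul hG).sub (hβc.mul ((((continuousOn_const.div hτ2 h2).neg).add
    (hn.div hτ4 h4)).mul hG)), fun i => hβc.mul (((hz i).div hτ2 h2).mul hG), fun i =>
    hβc.mul ((((continuousOn_const.div hτ2 h2).neg).add (((hz i).pow 2).div hτ4 h4)).mul hG),
    ?_, ?_, ?_, fun y hy => absurd (mem_univ y) hy⟩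
  · intro y s hs
    have h1 := hasDerivAt_heatKernel_time (x - y) (sub_pos.mpr (hI s hs))
    have h2 := h1.comp s ((hasDerivAt_id s).const_sub t)
    refine (((hβ.differentiable one_ne_zero).differentiableAt.hasDerivAt (x := s)).mul
      h2).congr_deriv ?_
    simp only [Function.comp_apply]
    ring
  · intro i y s hs
    have h1 := (hasLineDerivAt_heatKernel i (x - y) (sub_pos.mpr (hI s hs))).1.comp_const_sub
    refine (HasDerivAt.const_mul (β s) h1).congr_deriv ?_
    ring
  · intro i y s hs
    have h1 := (hasLineDerivAt_heatKernel i (x - y) (sub_pos.mpr (hI s hs))).2.comp_const_sub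
    refine (HasDerivAt.const_mul (-β s) h1).congr_deriv ?_ |>.congr_of_eventuallyEq
      (Eventually.of_forall fun h => ?_)
    · ring
    · simp only
      ring

/-- Applying the backward heat operator to a cutoff times the backward heat kernel only leaves
terms containing derivatives of the cutoff. -/
lemma cutoff_heat_identity (x y : 𝔼) {τ : ℝ} (hτ : 0 < τ) (a b b' : ℝ) (ai aii : Fin N → ℝ) :
    a * (b' * heatKernel (x - y, τ) - b * ((-(N / (2 * τ)) + ‖x - y‖ ^ 2 / (4 * τ ^ 2)) *
      heatKernel (x - y, τ))) +
    ∑ i, (aii i * (b * heatKernel (x - y, τ)) +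
      2 * ai i * (b * ((x - y) i / (2 * τ) * heatKernel (x - y, τ))) +
      a * (b * ((-(1 / (2 * τ)) + (x - y) i ^ 2 / (4 * τ ^ 2)) * heatKernel (x - y, τ)))) =
    (a * b' + (∑ i, aii i) * b) * heatKernel (x - y, τ) +
      ∑ i, (-2 * ai i * b) * fderiv ℝ heatKernel (x - y, τ) (𝐞 i, 0) := by
  have hn : ‖x - y‖ ^ 2 = ∑ i, (x - y) i ^ 2 := by
    simp [EuclideanSpace.norm_sq_eq]
  have hs : ∑ i, a * (b * ((-(1 / (2 * τ)) + (x - y) i ^ 2 / (4 * τ ^ 2)) *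
      heatKernel (x - y, τ))) = a * (b * ((-(N / (2 * τ)) + ‖x - y‖ ^ 2 / (4 * τ ^ 2)) *
      heatKernel (x - y, τ))) := by
    rw [← Finset.mul_sum, ← Finset.mul_sum, ← Finset.sum_mul, Finset.sum_add_distrib, hn,
      Finset.sum_div]
    simp
    ring_nf
    simp
  have h1 : ∑ i, 2 * ai i * (b * ((x - y) i / (2 * τ) * heatKernel (x - y, τ))) =
      ∑ i, (-2 * ai i * b) * fderiv ℝ heatKernel (x - y, τ) (𝐞 i, 0) := by
    refine Finset.sum_congr rfl fun i _ => ?_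
    rw [fderiv_heatKernel_of_pos i _ hτ]
    ring
  rw [Finset.sum_add_distrib, Finset.sum_add_distrib, hs, h1, ← Finset.sum_mul]
  ring

lemma exists_tendsto_integral_heatKernel : ∃ Z : ℝ, 0 < Z ∧ ∀ (g : 𝔼 → ℝ) (x : 𝔼),
    Integrable g → ContinuousAt g x →
    Tendsto (fun δ => ∫ y, g y * heatKernel (x - y, δ)) (𝓝[>] 0) (𝓝 (Z * g x)) := by
  let Z : ℝ := ∫ z : 𝔼, exp (-(1 / 4) * ‖z‖ ^ 2)
  have hZ : 0 < Z := by
    have := GaussianFourier.integral_rexp_neg_mul_sq_norm (V := 𝔼) (b := 1 / 4) (by norm_num)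
    simp only [Z, this]
    positivity
  refine ⟨Z, hZ, fun g x hg hgx => ?_⟩
  have hdecay : Tendsto (fun z : 𝔼 => ‖z‖ ^ Module.finrank ℝ 𝔼 *
      (Z⁻¹ * exp (-(1 / 4) * ‖z‖ ^ 2))) (Bornology.cobounded 𝔼) (𝓝 0) := by
    have h1 : Tendsto (fun z : 𝔼 => Z⁻¹ * (‖z‖ ^ Module.finrank ℝ 𝔼 * exp (-‖z‖)))
        (Bornology.cobounded 𝔼) (𝓝 0) := by
      simpa using ((tendsto_pow_mul_exp_neg_atTop_nhds_zero (Module.finrank ℝ 𝔼)).comp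
        tendsto_norm_cobounded_atTop).const_mul Z⁻¹
    refine squeeze_zero' (Eventually.of_forall fun z => by positivity) ?_ h1
    filter_upwards [tendsto_norm_cobounded_atTop.eventually_ge_atTop 4] with z hz
    have h2 : exp (-(1 / 4) * ‖z‖ ^ 2) ≤ exp (-‖z‖) := exp_le_exp.mpr (by nlinarith)
    calc ‖z‖ ^ Module.finrank ℝ 𝔼 * (Z⁻¹ * exp (-(1 / 4) * ‖z‖ ^ 2))
        = Z⁻¹ * (‖z‖ ^ Module.finrank ℝ 𝔼 * exp (-(1 / 4) * ‖z‖ ^ 2)) := by ring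
      _ ≤ _ := by gcongr
  have h := tendsto_integral_comp_smul_smul_of_integrable' (μ := (volume : Measure 𝔼))
    (φ := fun z : 𝔼 => Z⁻¹ * exp (-(1 / 4) * ‖z‖ ^ 2)) (fun z => by positivity)
    (by rw [integral_const_mul]; exact inv_mul_cancel₀ hZ.ne') hdecay hg hgx
  have hc : Tendsto (fun δ : ℝ => (√δ)⁻¹) (𝓝[>] 0) atTop := by
    refine tendsto_inv_nhdsGT_zero.comp (tendsto_nhdsWithin_iff.mpr ⟨?_, ?_⟩)
    · have := (continuous_sqrt.tendsto 0).mono_left (nhdsWithin_le_nhds (s := Ioi 0))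
      rwa [sqrt_zero] at this
    · filter_upwards [self_mem_nhdsWithin] with δ hδ using sqrt_pos.mpr hδ
  refine ((h.comp hc).const_mul Z).congr' ?_
  filter_upwards [self_mem_nhdsWithin] with δ hδ
  have hδ' : 0 < δ := hδ
  rw [Function.comp_apply, ← integral_const_mul]
  refine integral_congr_ae (Eventually.of_forall fun y => ?_)
  have h1 : (√δ)⁻¹ ^ Module.finrank ℝ 𝔼 = δ ^ (-((N : ℝ) / 2)) := by
    rw [finrank_euclideanSpace_fin, sqrt_eq_rpow, ← rpow_neg hδ'.le, ← rpow_natCast,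
      ← rpow_mul hδ'.le]
    congr 1
    ring
  have h2 : -(1 / 4) * ‖(√δ)⁻¹ • (x - y)‖ ^ 2 = -(‖x - y‖ ^ 2 / (4 * δ)) := by
    rw [norm_smul, mul_pow, norm_inv, norm_of_nonneg (sqrt_nonneg δ), inv_pow, sq_sqrt hδ'.le]
    field_simp
  simp only [smul_eq_mul]
  rw [heatKernel_of_pos _ hδ', h1, h2]
  field_simp

lemma exists_kernel_cutoff {r M : ℝ} (hr : 0 < r) (hM : 0 < M) : ∃ κ : 𝔼 × ℝ → ℝ,
    (∀ p, r ≤ ‖p‖ → ‖p‖ ≤ M → κ p = 1) ∧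
    ∀ F : 𝔼 × ℝ → ℝ, (∀ p ≠ 0, ContDiffAt ℝ 2 F p) →
      ContDiff ℝ 2 (fun p => κ p * F p) ∧ HasCompactSupport fun p => κ p * F p := by
  let big : ContDiffBump (0 : 𝔼 × ℝ) := ⟨M, M + 1, hM, by linarith⟩
  let small : ContDiffBump (0 : 𝔼 × ℝ) := ⟨r / 2, r, by linarith, by linarith⟩
  refine ⟨fun p => big p * (1 - small p), fun p h1 h2 => ?_, fun F hF => ⟨?_, ?_⟩⟩
  · have e1 : big p = 1 := big.one_of_mem_closedBall (by simpa using h2)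
    have e2 : small p = 0 := small.zero_of_le_dist (by simpa using h1)
    simp [e1, e2]
  · rw [contDiff_iff_contDiffAt]
    intro p
    by_cases hp : p = 0
    · subst hp
      refine (contDiffAt_const (c := (0 : ℝ))).congr_of_eventuallyEq ?_
      filter_upwards [small.eventuallyEq_one] with q hq
      simp [hq]
    · exact (big.contDiff.contDiffAt.mul (contDiffAt_const.sub small.contDiff.contDiffAt)).mul
        (hF p hp)
  · have : HasCompactSupport fun p => big p * ((1 - small p) * F p) :=
      big.hasCompactSupport.mul_right
    simpa only [mul_assoc] using this

lemma contDiff_setIntegral_mul_comp_sub {A : Set (𝔼 × ℝ)} (hA : MeasurableSet A)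
    {f k : 𝔼 × ℝ → ℝ} (hf : IntegrableOn f A) (hk : ContDiff ℝ 2 k) (hkc : HasCompactSupport k) :
    ContDiff ℝ 2 fun p => ∫ q in A, f q * k (p - q) := by
  have h := hkc.contDiff_convolution_right (n := 2) (μ := volume)
    (ContinuousLinearMap.mul ℝ ℝ) ((integrable_indicator_iff hA).mpr hf).locallyIntegrable hk
  have heq : (fun p => ∫ q in A, f q * k (p - q)) =
      convolution (A.indicator f) k (ContinuousLinearMap.mul ℝ ℝ) volume := by
    funext p
    rw [convolution_def, ← integral_indicator hA]
    refine integral_congr_ae (Eventually.of_forall fun q => ?_)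
    by_cases hq : q ∈ A <;> simp [hq]
  rw [heq]
  exact h

lemma setIntegral_prod_Icc_eq {K : Set 𝔼} (hK : MeasurableSet K) {a t b : ℝ} (htb : t ≤ b)
    (f : 𝔼 × ℝ → ℝ) {k : 𝔼 × ℝ → ℝ} (hk : ∀ p, p.2 ≤ 0 → k p = 0) (x : 𝔼) :
    ∫ q in K ×ˢ Icc a t, f q * k ((x, t) - q) = ∫ q in K ×ˢ Icc a b, f q * k ((x, t) - q) := by
  symm
  refine setIntegral_eq_of_subset_of_forall_sdiff_eq_zero (hK.prod measurableSet_Icc)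
    (prod_mono_right (Icc_subset_Icc_right htb)) fun q hq => ?_
  have h1 : t < q.2 := by
    by_contra hlt
    exact hq.2 ⟨hq.1.1, hq.1.2.1, not_lt.mp hlt⟩
  rw [hk _ (by simpa using h1.le), mul_zero]

lemma IsSmallNear.setIntegral_test {u : 𝔼 → ℝ → ℝ} {ξ : ℝ → 𝔼} {S : Set (𝔼 × ℝ)}
    {K : Set 𝔼} {a b Λ : ℝ} (h : IsSmallNear u ξ S K a b Λ) (hN : 1 ≤ N) (hab : a ≤ b)
    {φ φt : 𝔼 → ℝ → ℝ} {φi φii : Fin N → 𝔼 → ℝ → ℝ} (hφ : IsTest K (Icc a b) φ φt φi φii) :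
    ∫ p in K ×ˢ Icc a b, u p.1 p.2 * (φt p.1 p.2 + ∑ i, φii i p.1 p.2) =
      (∫ y, u y b * φ y b) - ∫ y, u y a * φ y a := by
  have hI := (h.integrableOn_mul hN (ψ := fun y s => φt y s + ∑ i, φii i y s)
    (hφ.cont_t.add (continuousOn_finsetSum Finset.univ fun i _ => hφ.cont_ii i))
    fun y hy s hs => by
      obtain ⟨-, e2, -, e4⟩ := hφ.zero y hy s hs
      simp [e2, e4]).2
  rw [← hI, ← h.integral_test hN hab hφ, intervalIntegral.integral_of_le hab,
    integral_Icc_eq_integral_Ioc]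

set_option maxHeartbeats 1000000 in
/-- A function as in `IsSmallNear` coincides, away from the curve, with a function which is of
class `C²` across the curve. -/
lemma IsSmallNear.exists_contDiff {u : 𝔼 → ℝ → ℝ} {ξ : ℝ → 𝔼} {S : Set (𝔼 × ℝ)} {c : 𝔼}
    {R a b Λ : ℝ} (h : IsSmallNear u ξ S (closedBall c (3 * R)) a b Λ) (hN : 1 ≤ N) (hR : 0 < R)
    {a₁ a₂ : ℝ} (h₁ : a < a₁) (h₂ : a₁ < a₂) (h₃ : a₂ < b) :
    ∃ W : 𝔼 × ℝ → ℝ, ContDiff ℝ 2 W ∧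
      ∀ x ∈ ball c R, ∀ t ∈ Ioo a₂ b, x ≠ ξ t → W (x, t) = u x t := by
  obtain ⟨Z, hZ, hlim⟩ := exists_tendsto_integral_heatKernel (N := N)
  let α : ContDiffBump c := ⟨2 * R, 3 * R, by linarith, by linarith⟩
  have hα : ContDiff ℝ 2 α := α.contDiff
  have hα0 : ∀ y ∈ (closedBall c (3 * R))ᶜ, α y = 0 := fun y hy =>
    α.zero_of_le_dist (le_of_lt (not_le.mp fun hle => hy hle))
  have hα1 : ∀ y ∈ ball c (2 * R), (α : 𝔼 → ℝ) =ᶠ[𝓝 y] fun _ => 1 := fun y hy =>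
    α.eventuallyEq_one_of_mem_ball hy
  obtain ⟨β, hβ, hβa, hβ1⟩ : ∃ β : ℝ → ℝ, ContDiff ℝ 1 β ∧ β a = 0 ∧ ∀ s, a₁ ≤ s → β s = 1 := by
    refine ⟨fun s => smoothTransition ((s - a) / (a₁ - a)),
      smoothTransition.contDiff.comp (by fun_prop), ?_, fun s hs => ?_⟩
    · simp [smoothTransition.zero]
    · refine smoothTransition.one_of_one_le ?_
      rw [le_div_iff₀ (by linarith)]
      linarith
  have hβ' : ∀ s, a₁ < s → deriv β s = 0 := fun s hs => by
    have hev : β =ᶠ[𝓝 s] fun _ => 1 := by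
      filter_upwards [eventually_gt_nhds hs] with s' hs' using hβ1 s' hs'.le
    rw [hev.deriv_eq, deriv_const]
  let αi : Fin N → 𝔼 → ℝ := fun i y => deriv (fun h : ℝ => α (y + h • 𝐞 i)) 0
  let αii : Fin N → 𝔼 → ℝ := fun i y => iteratedDeriv 2 (fun h : ℝ => α (y + h • 𝐞 i)) 0
  have hαi : ∀ i, Continuous (αi i) := fun i => (contDiff_lineDerivs_continuous hα (𝐞 i)).1
  have hαii : ∀ i, Continuous (αii i) := fun i => (contDiff_lineDerivs_continuous hα (𝐞 i)).2
  have hαi0 : ∀ i, ∀ y ∈ ball c (2 * R), αi i y = 0 ∧ αii i y = 0 := fun i y hy => by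
    obtain ⟨e1, e2⟩ := lineDerivs_congr (hα1 y hy) (𝐞 i)
    exact ⟨by simp [αi, e1], by simp [αii, e2, iteratedDeriv_const]⟩
  obtain ⟨κ, hκ, hκF⟩ := exists_kernel_cutoff (N := N) (r := min R (a₂ - a₁))
    (M := 4 * R + (b - a)) (lt_min hR (by linarith)) (by linarith)
  let k0 : 𝔼 × ℝ → ℝ := fun p => κ p * heatKernel p
  let k : Fin N → 𝔼 × ℝ → ℝ := fun i p => κ p * fderiv ℝ heatKernel p (𝐞 i, 0)
  obtain ⟨hk0, hk0c⟩ := hκF heatKernel fun p hp => contDiffAt_heatKernel 2 hp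
  have hk : ∀ i, ContDiff ℝ 2 (k i) ∧ HasCompactSupport (k i) := fun i =>
    hκF (fun p => fderiv ℝ heatKernel p (𝐞 i, 0)) fun p hp =>
      ((contDiffAt_heatKernel 3 hp).fderiv_right (m := 2) (by norm_num)).clm_apply contDiffAt_const
  have hk0z : ∀ p : 𝔼 × ℝ, p.2 ≤ 0 → k0 p = 0 := fun p hp => by
    simp only [k0, heatKernel_of_nonpos hp, mul_zero]
  have hkz : ∀ i, ∀ p : 𝔼 × ℝ, p.2 ≤ 0 → k i p = 0 := fun i p hp => by
    simp [k, fderiv_heatKernel_of_nonpos hp]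
  let b0 : 𝔼 × ℝ → ℝ := fun q => α q.1 * deriv β q.2 + (∑ i, αii i q.1) * β q.2
  let bi : Fin N → 𝔼 × ℝ → ℝ := fun i q => -2 * αi i q.1 * β q.2
  have hb0 : Continuous b0 := by
    refine ((hα.continuous.comp continuous_fst).mul
      ((hβ.continuous_deriv le_rfl).comp continuous_snd)).add
      (Continuous.mul ?_ (hβ.continuous.comp continuous_snd))
    exact continuous_finsetSum _ fun i _ => (hαii i).comp continuous_fst
  have hbi : ∀ i, Continuous (bi i) := fun i =>
    (continuous_const.mul ((hαi i).comp continuous_fst)).mul (hβ.continuous.comp continuous_snd)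
  have hKc : ∀ m, IsCompact (closedBall c (3 * R) ×ˢ Icc a m) := fun m =>
    (isCompact_closedBall c (3 * R)).prod isCompact_Icc
  have hKm : ∀ m, MeasurableSet (closedBall c (3 * R) ×ˢ Icc a m) := fun m =>
    (hKc m).measurableSet
  let f0 : 𝔼 × ℝ → ℝ := fun q => u q.1 q.2 * b0 q
  let f : Fin N → 𝔼 × ℝ → ℝ := fun i q => u q.1 q.2 * bi i q
  have hf0 : ∀ m ≤ b, IntegrableOn f0 (closedBall c (3 * R) ×ˢ Icc a m) := fun m hm =>
    ((h.mono hm).integrableOn hN).mul_continuousOn hb0.continuousOn (hKc m)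
  have hf : ∀ m ≤ b, ∀ i, IntegrableOn (f i) (closedBall c (3 * R) ×ˢ Icc a m) := fun m hm i =>
    ((h.mono hm).integrableOn hN).mul_continuousOn (hbi i).continuousOn (hKc m)
  let V : ℝ → 𝔼 × ℝ → ℝ := fun m p =>
    (∫ q in closedBall c (3 * R) ×ˢ Icc a m, f0 q * k0 (p - q)) +
      ∑ i, ∫ q in closedBall c (3 * R) ×ˢ Icc a m, f i q * k i (p - q)
  have hV : ∀ m ≤ b, ContDiff ℝ 2 (V m) := fun m hm =>
    (contDiff_setIntegral_mul_comp_sub (hKm m) (hf0 m hm) hk0 hk0c).add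
      (ContDiff.sum fun i _ => contDiff_setIntegral_mul_comp_sub (hKm m) (hf m hm i)
        (hk i).1 (hk i).2)
  refine ⟨fun p => Z⁻¹ * V b p, contDiff_const.mul (hV b le_rfl), fun x hx t ht hxt => ?_⟩
  have hat : a ≤ t := by linarith [ht.1]
  have htb : t ≤ b := ht.2.le
  have htI : t ∈ Icc a b := ⟨hat, htb⟩
  have hx3 : x ∈ closedBall c (3 * R) :=
    closedBall_subset_closedBall (by linarith) (ball_subset_closedBall hx)
  have hVt : V t (x, t) = V b (x, t) := by
    simp only [V]
    rw [setIntegral_prod_Icc_eq measurableSet_closedBall htb f0 hk0z]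
    congr 1
    exact Finset.sum_congr rfl fun i _ =>
      setIntegral_prod_Icc_eq measurableSet_closedBall htb (f i) (hkz i) x
  have hlim1 : Tendsto (fun δ => V t (x, t + δ)) (𝓝[>] 0) (𝓝 (V t (x, t))) := by
    have hc : Continuous fun δ : ℝ => V t (x, t + δ) :=
      (hV t htb).continuous.comp (by fun_prop)
    simpa using (hc.tendsto 0).mono_left nhdsWithin_le_nhds
  have hux : ContinuousAt (fun y => u y t) x := by
    have hS : (x, t) ∈ S := h.mem x hx3 t htI hxt
    have h1 : ContinuousAt (fun p : 𝔼 × ℝ => u p.1 p.2) (x, t) :=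
      h.heat.1.continuousAt (h.isOpen.mem_nhds hS)
    exact ContinuousAt.comp (f := fun y : 𝔼 => (y, t)) h1 (by fun_prop)
  have hlim2 := hlim (fun y => u y t * α y) x
    (h.integrable_mul hN (ψ := fun y _ => α y) htI hα.continuous.continuousOn
      fun y hy => hα0 y hy) (hux.mul hα.continuous.continuousAt)
  have hαx : α x = 1 := (hα1 x (ball_subset_ball (by linarith) hx)).self_of_nhds
  rw [hαx, mul_one] at hlim2
  have hkey : ∀ δ ∈ Ioo 0 (b - t),
      ∫ y, u y t * α y * heatKernel (x - y, δ) = V t (x, t + δ) := by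
    intro δ hδ
    have hlt : ∀ s ∈ Icc a t, s < t + δ := fun s hs => by linarith [hs.2, hδ.1]
    have T := (isTest_heatKernel hβ x hlt).mul hα isClosed_closedBall.isOpen_compl hα0
    rw [Set.sdiff_compl, univ_inter] at T
    have E := (h.mono htb).setIntegral_test hN hat T
    simp only [hβa, hβ1 t (by linarith [ht.1]), zero_mul, mul_zero, integral_zero, sub_zero,
      one_mul, add_sub_cancel_left] at E
    simp only [mul_assoc]
    rw [← E]
    have hmulint : ∀ {g k : 𝔼 × ℝ → ℝ}, IntegrableOn g (closedBall c (3 * R) ×ˢ Icc a t) →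
        ContDiff ℝ 2 k → IntegrableOn (fun q => g q * k ((x, t + δ) - q))
          (closedBall c (3 * R) ×ˢ Icc a t) := fun hg hk =>
      hg.mul_continuousOn (hk.continuous.comp (by fun_prop)).continuousOn (hKc t)
    simp only [V]
    rw [← integral_finsetSum _ fun i _ => hmulint (hf t htb i) (hk i).1, ← integral_add
      (hmulint (hf0 t htb) hk0) (integrable_finsetSum _ fun i _ => hmulint (hf t htb i) (hk i).1)]
    refine setIntegral_congr_fun (hKm t) fun q hq => ?_
    obtain ⟨y, s⟩ := q
    have hy : y ∈ closedBall c (3 * R) := hq.1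
    have hs : s ∈ Icc a t := hq.2
    have hid := cutoff_heat_identity x y (sub_pos.mpr (hlt s hs)) (α y) (β s) (deriv β s)
      (fun i => αi i y) fun i => αii i y
    have hκ1 : (R ≤ ‖x - y‖ ∨ s ≤ a₁) → κ (x - y, t + δ - s) = 1 := by
      intro hor
      refine hκ _ ?_ ?_
      · rcases hor with hor | hor
        · exact (min_le_left _ _).trans (hor.trans (norm_fst_le (x - y, t + δ - s)))
        · refine (min_le_right _ _).trans (le_trans ?_ (norm_snd_le (x - y, t + δ - s)))
          exact le_trans (by linarith [ht.1, hδ.1]) (le_abs_self _)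
      · rw [Prod.norm_def]
        refine max_le ?_ ?_
        · have e1 := mem_ball_iff_norm.mp hx
          have e2 := mem_closedBall_iff_norm'.mp hy
          have e3 := norm_sub_le_norm_sub_add_norm_sub x c y
          simp only
          linarith
        · simp only [Real.norm_eq_abs]
          rw [abs_of_pos (sub_pos.mpr (hlt s hs))]
          linarith [hs.1, hδ.2]
    have hfar : y ∉ ball c (2 * R) → R ≤ ‖x - y‖ := fun hy2 => by
      have e1 := mem_ball_iff_norm.mp hx
      rw [mem_ball_iff_norm, not_lt] at hy2
      have e3 := norm_sub_le_norm_sub_add_norm_sub y x c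
      rw [norm_sub_rev y x] at e3
      linarith
    have hb0κ : b0 (y, s) * heatKernel (x - y, t + δ - s) =
        b0 (y, s) * k0 (x - y, t + δ - s) := by
      by_cases hor : R ≤ ‖x - y‖ ∨ s ≤ a₁
      · simp only [k0, hκ1 hor, one_mul]
      · push Not at hor
        have hy2 : y ∈ ball c (2 * R) := by
          by_contra hy2
          exact absurd (hfar hy2) (not_le.mpr hor.1)
        simp [b0, hβ' s hor.2, (hαi0 _ y hy2).2]
    have hbiκ : ∀ i, bi i (y, s) * fderiv ℝ heatKernel (x - y, t + δ - s) (𝐞 i, 0) =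
        bi i (y, s) * k i (x - y, t + δ - s) := fun i => by
      by_cases hy2 : y ∈ ball c (2 * R)
      · simp [bi, (hαi0 i y hy2).1]
      · simp only [k, hκ1 (Or.inl (hfar hy2)), one_mul]
    calc _ = u y s * (b0 (y, s) * heatKernel (x - y, t + δ - s) +
        ∑ i, bi i (y, s) * fderiv ℝ heatKernel (x - y, t + δ - s) (𝐞 i, 0)) := by
          exact congrArg (u y s * ·) hid
      _ = _ := by
          rw [hb0κ, Finset.sum_congr rfl fun i _ => hbiκ i, mul_add, Finset.mul_sum]
          simp only [f0, f, k0, mul_assoc, Prod.mk_sub_mk]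
  have hlim3 : Tendsto (fun δ => V t (x, t + δ)) (𝓝[>] 0) (𝓝 (Z * u x t)) := by
    refine hlim2.congr' ?_
    filter_upwards [Ioo_mem_nhdsGT (sub_pos.mpr ht.2)] with δ hδ using hkey δ hδ
  have heq := tendsto_nhds_unique hlim1 hlim3
  simp only
  rw [← hVt, heq, inv_mul_cancel_left₀ hZ.ne']

lemma IsHeatSolution.of_local {v : 𝔼 → ℝ → ℝ} {S : Set (𝔼 × ℝ)}
    (h : ∀ p ∈ S, ∃ U, IsOpen U ∧ p ∈ U ∧ IsHeatSolution v U) : IsHeatSolution v S := by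
  refine ⟨fun p hp => ?_, fun p hp => ?_⟩
  · obtain ⟨U, hU, hpU, hv⟩ := h p hp
    exact (hv.1.continuousAt (hU.mem_nhds hpU)).continuousWithinAt
  · obtain ⟨U, -, hpU, hv⟩ := h p hp
    exact hv.2 p hpU

lemma isHeatSolution_of_contDiff (hN : 1 ≤ N) {W : 𝔼 × ℝ → ℝ} (hW : ContDiff ℝ 2 W)
    {U : Set (𝔼 × ℝ)} (hU : IsOpen U) {ξ : ℝ → 𝔼}
    (h : IsHeatSolution (fun x t => W (x, t)) {p | p ∈ U ∧ p.1 ≠ ξ p.2}) :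
    IsHeatSolution (fun x t => W (x, t)) U := by
  have hslice : ∀ t, ContDiff ℝ 2 fun x => W (x, t) := fun t => hW.comp (by fun_prop)
  have htime : ∀ x t, HasDerivAt (fun τ => W (x, τ)) (fderiv ℝ W (x, t) (0, 1)) t := fun x t => by
    have h1 := ((hW.differentiable two_ne_zero).differentiableAt (x := (x, t))).hasFDerivAt
    exact h1.comp_hasDerivAt t ((hasDerivAt_const t x).prodMk (hasDerivAt_id t))
  refine ⟨hW.continuous.continuousOn, fun ⟨x, t⟩ hp => ⟨(hslice t).contDiffAt, ?_⟩⟩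
  refine (htime x t).congr_deriv ?_
  have : Nonempty (Fin N) := ⟨⟨0, hN⟩⟩
  have : Nontrivial 𝔼 := inferInstance
  have hl : Tendsto (fun y => fderiv ℝ W (y, t) (0, 1)) (𝓝[≠] x)
      (𝓝 (fderiv ℝ W (x, t) (0, 1))) := by
    have hc : Continuous fun y : 𝔼 => fderiv ℝ W (y, t) (0, 1) :=
      ((hW.continuous_fderiv two_ne_zero).comp (by fun_prop)).clm_apply continuous_const
    exact (hc.tendsto x).mono_left nhdsWithin_le_nhds
  have hr : Tendsto (fun y => ∑ i, iteratedDeriv 2 (fun h : ℝ => W (y + h • 𝐞 i, t)) 0) (𝓝[≠] x)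
      (𝓝 (∑ i, iteratedDeriv 2 (fun h : ℝ => W (x + h • 𝐞 i, t)) 0)) := by
    have hc : Continuous fun y : 𝔼 => ∑ i, iteratedDeriv 2 (fun h : ℝ => W (y + h • 𝐞 i, t)) 0 :=
      continuous_finsetSum _ fun i _ => (contDiff_lineDerivs_continuous (hslice t) (𝐞 i)).2
    exact (hc.tendsto x).mono_left nhdsWithin_le_nhds
  by_cases hx : x = ξ t
  · refine tendsto_nhds_unique hl (hr.congr' ?_)
    have ht : Tendsto (fun y : 𝔼 => (y, t)) (𝓝 x) (𝓝 (x, t)) :=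
      Continuous.tendsto (by fun_prop : Continuous fun y : 𝔼 => (y, t)) x
    filter_upwards [nhdsWithin_le_nhds (ht.eventually (hU.mem_nhds hp)), self_mem_nhdsWithin]
      with y hy hyx
    exact ((h.2 (y, t) ⟨hy, fun e => hyx (e.trans hx.symm)⟩).2).unique (htime y t)
  · exact (htime x t).unique (h.2 (x, t) ⟨hp, hx⟩).2

lemma isOpen_off_curve {ξ : ℝ → 𝔼} {I : Set ℝ} (hξ : ContinuousOn ξ I) {U : Set (𝔼 × ℝ)}
    (hU : IsOpen U) (hUI : ∀ p ∈ U, p.2 ∈ I) : IsOpen {p | p ∈ U ∧ p.1 ≠ ξ p.2} := by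
  have hc : ContinuousOn (fun p : 𝔼 × ℝ => p.1 - ξ p.2) U :=
    continuousOn_fst.sub (hξ.comp continuousOn_snd hUI)
  have := hc.isOpen_inter_preimage hU (isOpen_ne (x := (0 : 𝔼)))
  convert this using 1
  ext p
  simp [sub_eq_zero]

end Helpers

open Filter Topology

/-- sufficiency in Theorem 1.1: for N ≥ 3, a moving singularity along a
Hölder-1/2 curve is removable provided u = o(|x-ξ(t)|^{2-N}) near the curve, uniformly on
compact time intervals. -/
theorem removable_singularity_of_small {N : ℕ} (hN : 3 ≤ N) (T : ℝ) (hT : 0 < T)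
    (L : ℝ) (ξ : ℝ → EuclideanSpace ℝ (Fin N))
    (hHolder : ∀ a ∈ Icc (0 : ℝ) T, ∀ b ∈ Icc (0 : ℝ) T,
      ‖ξ a - ξ b‖ ≤ L * |a - b| ^ ((1 : ℝ) / 2))
    (Ω : Set (EuclideanSpace ℝ (Fin N))) (hΩ : IsOpen Ω) (hΩc : IsConnected Ω)
    (hξΩ : ∀ t ∈ Icc (0 : ℝ) T, ξ t ∈ Ω)
    (u : EuclideanSpace ℝ (Fin N) → ℝ → ℝ)
    (hu : IsHeatSolution u {p | p.1 ∈ Ω ∧ p.1 ≠ ξ p.2 ∧ p.2 ∈ Ioo 0 T})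
    (hsmall : ∀ t₁ t₂ : ℝ, 0 < t₁ → t₁ < t₂ → t₂ < T → ∀ ε ∈ Ioo (0 : ℝ) 1,
      ∃ r ∈ Ioo (0 : ℝ) 1, ∀ t ∈ Icc t₁ t₂, ∀ x : EuclideanSpace ℝ (Fin N),
        x ≠ ξ t → ‖x - ξ t‖ < r → |u x t| ≤ ε * ‖x - ξ t‖ ^ ((2 : ℝ) - N)) :
    ∃ v : EuclideanSpace ℝ (Fin N) → ℝ → ℝ,
      IsHeatSolution v (Ω ×ˢ Ioo 0 T) ∧
      ∀ p : EuclideanSpace ℝ (Fin N) × ℝ,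
        p.1 ∈ Ω → p.1 ≠ ξ p.2 → p.2 ∈ Ioo 0 T → v p.1 p.2 = u p.1 p.2 := by
  have hΛ : ∀ s ∈ Icc 0 T, ∀ s' ∈ Icc 0 T, ‖ξ s - ξ s'‖ ≤ |L| * √|s - s'| := by
    intro s hs s' hs'
    rw [sqrt_eq_rpow]
    exact (hHolder s hs s' hs').trans (by gcongr; exact le_abs_self L)
  have hξ : ContinuousOn ξ (Icc 0 T) := continuousOn_of_norm_sub_le_sqrt hΛ
  have hD : IsOpen {p : EuclideanSpace ℝ (Fin N) × ℝ |
      p.1 ∈ Ω ∧ p.1 ≠ ξ p.2 ∧ p.2 ∈ Ioo 0 T} := by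
    have := isOpen_off_curve hξ (hΩ.prod isOpen_Ioo) fun p hp => Ioo_subset_Icc_self hp.2
    convert this using 1
    ext p
    simp only [mem_ofPred_eq, mem_prod]
    tauto
  have : Nonempty (Fin N) := ⟨⟨0, by omega⟩⟩
  have : Nontrivial (EuclideanSpace ℝ (Fin N)) := inferInstance
  classical
  refine ⟨fun x t => if x = ξ t then limUnder (𝓝[≠] x) (fun y => u y t) else u x t,
    IsHeatSolution.of_local ?_, fun p _ hp _ => if_neg hp⟩
  rintro ⟨x, t⟩ ⟨hx, ht⟩
  by_cases hxt : x = ξ t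
  swap
  · exact ⟨_, hD, ⟨hx, hxt, ht⟩, hu.congr hD fun p hp => if_neg hp.2.1⟩
  have ht0 : 0 < t := ht.1
  have htT : t < T := ht.2
  obtain ⟨ρ, hρ, hρΩ⟩ := Metric.isOpen_iff.mp hΩ x hx
  have hsub : Icc (t / 2) ((t + T) / 2) ⊆ Ioo 0 T := fun s hs =>
    ⟨by linarith [hs.1], by linarith [hs.2]⟩
  have hnear : IsSmallNear (fun y s => if y = ξ s then 0 else u y s) ξ
      {p | p.1 ∈ Ω ∧ p.1 ≠ ξ p.2 ∧ p.2 ∈ Ioo 0 T} (closedBall x (3 * (ρ / 4)))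
      (t / 2) ((t + T) / 2) |L| := by
    refine ⟨hD, hu.congr hD fun p hp => if_neg hp.2.1, fun y hy s hs hys =>
      ⟨hρΩ (closedBall_subset_ball (by linarith) hy), hys, hsub hs⟩, isCompact_closedBall _ _,
      fun s _ => if_pos rfl, abs_nonneg L, fun s hs s' hs' =>
      hΛ s (Ioo_subset_Icc_self (hsub hs)) s' (Ioo_subset_Icc_self (hsub hs')), fun ε hε => ?_⟩
    obtain ⟨r, hr, H⟩ := hsmall (t / 2) ((t + T) / 2) (by linarith) (by linarith) (by linarith)
      (min ε (1 / 2)) ⟨lt_min hε (by norm_num), (min_le_right _ _).trans_lt (by norm_num)⟩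
    refine ⟨r, hr.1, fun s hs y hy => ?_⟩
    split_ifs with hys
    · rw [abs_zero]
      positivity
    · exact (H s hs y hys hy).trans (by gcongr; exact min_le_left _ _)
  obtain ⟨W, hW, hWu⟩ := hnear.exists_contDiff (by omega) (by linarith)
    (a₁ := 2 * t / 3) (a₂ := 3 * t / 4) (by linarith) (by linarith) (by linarith)
  let U : Set (EuclideanSpace ℝ (Fin N) × ℝ) :=
    ball x (ρ / 4) ×ˢ Ioo (3 * t / 4) ((t + T) / 2)
  have hU : IsOpen U := isOpen_ball.prod isOpen_Ioo
  have hUT : ∀ p ∈ U, p.2 ∈ Ioo 0 T := fun p hp =>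
    ⟨by linarith [hp.2.1], by linarith [hp.2.2]⟩
  have hUW : ∀ p ∈ U, p.1 ≠ ξ p.2 → W (p.1, p.2) = u p.1 p.2 := fun p hp hne =>
    (hWu p.1 hp.1 p.2 hp.2 hne).trans (if_neg hne)
  have hWheat : IsHeatSolution (fun y s => W (y, s)) U := by
    refine isHeatSolution_of_contDiff (ξ := ξ) (by omega) hW hU ?_
    refine (hu.mono fun p hp => ⟨hρΩ (ball_subset_ball (by linarith) hp.1.1), hp.2,
      hUT p hp.1⟩).congr (isOpen_off_curve hξ hU fun p hp => Ioo_subset_Icc_self (hUT p hp))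
      fun p hp => hUW p hp.1 hp.2
  refine ⟨U, hU, ⟨mem_ball_self (by linarith), by linarith, by linarith⟩, hWheat.congr hU ?_⟩
  intro p hp
  by_cases hps : p.1 = ξ p.2
  swap
  · rw [if_neg hps, hUW p hp hps]
  · rw [if_pos hps]
    refine Tendsto.limUnder_eq ?_
    have hc : Continuous fun y => W (y, p.2) := hW.continuous.comp (by fun_prop)
    refine ((hc.tendsto p.1).mono_left nhdsWithin_le_nhds).congr' ?_
    have hb : ∀ᶠ y in 𝓝 p.1, y ∈ ball x (ρ / 4) := isOpen_ball.mem_nhds hp.1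
    filter_upwards [nhdsWithin_le_nhds hb, self_mem_nhdsWithin] with y hy hyp
    exact hUW (y, p.2) ⟨hy, hp.2⟩ fun e => hyp (e.trans hps.symm)
end
end

section
/- Let ξ : [0,T] → ℝ^N be Hölder continuous with exponent α > 0. Then there exists a family of smooth functions {η^r}_{r>0} ⊂ C^∞(ℝ^N × (0,T)) and a constant C > 0 independent of x, t, r such that: η^r(x,t) = 1 if |x-ξ(t)| > r, η^r(x,t) = 0 if |x-ξ(t)| < r/2, 0 ≤ η^r ≤ 1, |∇_x η^r| ≤ C r^{-1}, |Δ_x η^r| ≤ C r^{-2}, and |∂_t η^r| ≤ C r^{-1/α}. -/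
open MeasureTheory Real Set Metric

noncomputable section

open scoped Convolution

/-- A fixed mollifier on `ℝ` smooths every function with modulus of continuity `c * |·| ^ α`,
moving it by at most `c` and with derivative bounded by a multiple of `c`. -/
theorem exists_smooth_approx_of_holder {E : Type*} [NormedAddCommGroup E] [NormedSpace ℝ E]
    [CompleteSpace E] :
    ∃ M : ℝ, 0 ≤ M ∧ ∀ (α c : ℝ) (ζ : ℝ → E), 0 < α → 0 ≤ c →
      (∀ a b, ‖ζ a - ζ b‖ ≤ c * |a - b| ^ α) →
      ∃ g : ℝ → E, ContDiff ℝ (⊤ : ℕ∞) g ∧ ∀ t, ‖g t - ζ t‖ ≤ c ∧ ‖deriv g t‖ ≤ M * c := by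
  let φ : ContDiffBump (0 : ℝ) := ⟨1 / 2, 1, by norm_num, by norm_num⟩
  let ρ : ℝ → ℝ := φ.normed volume
  have hρ : ContDiff ℝ (⊤ : ℕ∞) ρ := φ.contDiff_normed
  have hρ_supp : HasCompactSupport ρ := φ.hasCompactSupport_normed
  have hρ_cont : Continuous (deriv ρ) := hρ.continuous_deriv (by simp)
  have hρ_int : Integrable (deriv ρ) := hρ_cont.integrable_of_hasCompactSupport hρ_supp.deriv
  have hρ_zero : ∫ s, deriv ρ s = 0 :=
    integral_eq_zero_of_hasDerivAt_of_integrable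
      (fun s => (hρ.differentiable (by simp) s).hasDerivAt) hρ_int
      (hρ.continuous.integrable_of_hasCompactSupport hρ_supp)
  have hρ_out : ∀ s, 1 < |s| → deriv ρ s = 0 := fun s hs => by
    have hs' : s ∉ tsupport ρ := by
      rw [show tsupport ρ = closedBall 0 1 from φ.tsupport_normed_eq]
      simpa using hs
    exact image_eq_zero_of_notMem_tsupport fun h => hs' (tsupport_deriv_subset h)
  refine ⟨∫ s, ‖deriv ρ s‖, integral_nonneg fun _ => norm_nonneg _, ?_⟩
  intro α c ζ hα hc hζ
  have hζ_near : ∀ a b, |a - b| ≤ 1 → ‖ζ a - ζ b‖ ≤ c := fun a b hab =>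
    (hζ a b).trans (mul_le_of_le_one_right hc (rpow_le_one (abs_nonneg _) hab hα.le))
  have hζ_cont : Continuous ζ := by
    refine continuous_iff_continuousAt.2 fun b => tendsto_iff_norm_sub_tendsto_zero.2 ?_
    refine squeeze_zero (fun _ => norm_nonneg _) (fun a => hζ a b) ?_
    have : Continuous fun a : ℝ => c * |a - b| ^ α :=
      continuous_const.mul ((continuous_id.sub continuous_const).abs.rpow_const
        fun _ => Or.inr hα.le)
    simpa [hα.ne'] using this.tendsto b
  have hζ_loc := hζ_cont.locallyIntegrable (μ := volume)
  refine ⟨ρ ⋆[ContinuousLinearMap.lsmul ℝ ℝ, volume] ζ,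
    hρ_supp.contDiff_convolution_left _ hρ hζ_loc, fun t => ⟨?_, ?_⟩⟩
  · rw [← dist_eq_norm]
    refine φ.dist_normed_convolution_le hζ_cont.aestronglyMeasurable fun s hs => ?_
    rw [dist_eq_norm]
    refine hζ_near s t ?_
    rw [mem_ball, Real.dist_eq] at hs
    exact hs.le
  · rw [(hρ_supp.hasDerivAt_convolution_left _ (hρ.of_le (by simp)) hζ_loc t).deriv]
    have hconv : Integrable fun s => deriv ρ s • ζ (t - s) :=
      (hρ_cont.smul (hζ_cont.comp
        (continuous_const.sub continuous_id))).integrable_of_hasCompactSupport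
        hρ_supp.deriv.smul_right
    have hrepr : (deriv ρ ⋆[ContinuousLinearMap.lsmul ℝ ℝ, volume] ζ) t =
        ∫ s, deriv ρ s • (ζ (t - s) - ζ t) := by
      simp only [smul_sub]
      rw [integral_sub hconv (hρ_int.smul_const _), integral_smul_const, hρ_zero, zero_smul,
        sub_zero]
      rfl
    rw [hrepr, ← integral_mul_const]
    refine norm_integral_le_of_norm_le (hρ_int.norm.mul_const c) (.of_forall fun s => ?_)
    rw [norm_smul]
    rcases le_or_gt |s| 1 with hs | hs
    · exact mul_le_mul_of_nonneg_left (hζ_near _ _ (by simpa using hs)) (norm_nonneg _)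
    · simp [hρ_out s hs]

/-- A smooth function vanishing on the ball of radius `5/8`, equal to `1` outside the ball of
radius `7/8`, with bounded first and second derivatives. -/
theorem exists_smooth_cutoff {E : Type*} [NormedAddCommGroup E] [InnerProductSpace ℝ E]
    [FiniteDimensional ℝ E] {ι : Type*} [Fintype ι] (e : ι → E) :
    ∃ (F : E → ℝ) (A B : ℝ), ContDiff ℝ (⊤ : ℕ∞) F ∧
      (∀ y, 7 / 8 ≤ ‖y‖ → F y = 1) ∧ (∀ y, ‖y‖ ≤ 5 / 8 → F y = 0) ∧
      (∀ y, 0 ≤ F y ∧ F y ≤ 1) ∧ (∀ y, ‖fderiv ℝ F y‖ ≤ A) ∧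
      ∀ y, |∑ i, fderiv ℝ (fun z => fderiv ℝ F z (e i)) y (e i)| ≤ B := by
  let φ : ContDiffBump (0 : E) := ⟨5 / 8, 7 / 8, by norm_num, by norm_num⟩
  have hφ : ContDiff ℝ (⊤ : ℕ∞) φ := φ.contDiff
  have hφ' : ContDiff ℝ (⊤ : ℕ∞) (fderiv ℝ φ) := hφ.fderiv_right (by simp)
  have hφ'' : ∀ i, ContDiff ℝ (⊤ : ℕ∞) fun z => fderiv ℝ φ z (e i) := fun i =>
    hφ'.clm_apply contDiff_const
  have hfd : fderiv ℝ (fun y => 1 - φ y) = fun y => -fderiv ℝ φ y := by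
    funext y
    exact fderiv_const_sub 1
  obtain ⟨A, hA⟩ := hφ'.continuous.bounded_above_of_compact_support (φ.hasCompactSupport.fderiv ℝ)
  have hB : ∀ i, ∃ B, ∀ y, ‖fderiv ℝ (fun z => fderiv ℝ φ z (e i)) y (e i)‖ ≤ B := fun i =>
    (((hφ'' i).continuous_fderiv (by simp)).clm_apply
      continuous_const).bounded_above_of_compact_support
      ((φ.hasCompactSupport.fderiv_apply ℝ (e i)).fderiv_apply ℝ (e i))
  choose B hB using hB
  refine ⟨fun y => 1 - φ y, A, ∑ i, B i, contDiff_const.sub hφ, fun y hy => ?_, fun y hy => ?_,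
    fun y => ⟨sub_nonneg.2 φ.le_one, sub_le_self _ φ.nonneg⟩, fun y => ?_, fun y => ?_⟩
  · simp [φ.zero_of_le_dist (show φ.rOut ≤ dist y 0 by simpa using hy)]
  · simp [φ.one_of_mem_closedBall (show y ∈ closedBall 0 φ.rIn by simpa using hy)]
  · rw [hfd, norm_neg]
    exact hA y
  · refine (Finset.abs_sum_le_sum_abs _ _).trans (Finset.sum_le_sum fun i _ => ?_)
    have : (fun z => fderiv ℝ (fun y => 1 - φ y) z (e i)) = fun z => -(fderiv ℝ φ z (e i)) := by
      simp [hfd]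
    rw [this, fderiv_fun_neg, neg_apply, abs_neg]
    exact hB i y

/-- The second derivative of `F` along the line `h ↦ z + (k * h) • v`. -/
theorem iteratedDeriv_two_comp_line {E : Type*} [NormedAddCommGroup E] [NormedSpace ℝ E]
    {F : E → ℝ} (hF : ContDiff ℝ (⊤ : ℕ∞) F) (z v : E) (k : ℝ) :
    iteratedDeriv 2 (fun h : ℝ => F (z + (k * h) • v)) 0 =
      k ^ 2 * fderiv ℝ (fun y => fderiv ℝ F y v) z v := by
  have hline : ∀ h : ℝ, HasDerivAt (fun h : ℝ => z + (k * h) • v) (k • v) h := fun h => by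
    simpa using (((hasDerivAt_id h).const_mul k).smul_const v).const_add z
  have hcomp : ∀ {G : E → ℝ}, ContDiff ℝ (⊤ : ℕ∞) G → ∀ h : ℝ,
      HasDerivAt (fun h : ℝ => G (z + (k * h) • v)) (k * fderiv ℝ G (z + (k * h) • v) v) h := by
    intro G hG h
    simpa [Function.comp_def] using ((hG.differentiable (by simp) _).hasFDerivAt.comp_hasDerivAt h (hline h))
  have hF' : ContDiff ℝ (⊤ : ℕ∞) fun y => fderiv ℝ F y v :=
    (hF.fderiv_right (by simp)).clm_apply contDiff_const
  rw [iteratedDeriv_succ, iteratedDeriv_one, funext fun h => (hcomp hF h).deriv,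
    ((hcomp hF' 0).const_mul k).deriv]
  simp only [mul_zero, zero_smul, add_zero]
  ring

/-- Lemma 2.1: cut-off functions around a Hölder continuous moving point,
with gradient bound C/r, Laplacian bound C/r², and time-derivative bound C r^{-1/α}. -/
theorem exists_cutoff_family {N : ℕ} (T α L : ℝ) (hT : 0 < T) (hα : 0 < α) (hL : 0 < L)
    (ξ : ℝ → EuclideanSpace ℝ (Fin N))
    (hHolder : ∀ a ∈ Icc (0 : ℝ) T, ∀ b ∈ Icc (0 : ℝ) T, ‖ξ a - ξ b‖ ≤ L * |a - b| ^ α) :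
    ∃ C : ℝ, 0 < C ∧ ∃ η : ℝ → EuclideanSpace ℝ (Fin N) → ℝ → ℝ,
      ∀ r : ℝ, 0 < r →
        ContDiff ℝ (⊤ : ℕ∞) (fun p : EuclideanSpace ℝ (Fin N) × ℝ => η r p.1 p.2) ∧
        ∀ t ∈ Ioo (0 : ℝ) T, ∀ x : EuclideanSpace ℝ (Fin N),
          (r < ‖x - ξ t‖ → η r x t = 1) ∧
          (‖x - ξ t‖ < r / 2 → η r x t = 0) ∧
          0 ≤ η r x t ∧ η r x t ≤ 1 ∧
          ‖fderiv ℝ (fun y => η r y t) x‖ ≤ C / r ∧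
          |∑ i, iteratedDeriv 2
            (fun h : ℝ => η r (x + h • EuclideanSpace.single i (1 : ℝ)) t) 0| ≤ C / r ^ 2 ∧
          |deriv (fun τ => η r x τ) t| ≤ C * r ^ (-(1 / α)) := by
  have hT' : (0 : ℝ) ≤ T := hT.le
  let ξ' : ℝ → EuclideanSpace ℝ (Fin N) := fun t => ξ (projIcc 0 T hT' t)
  have hξ' : ∀ a b, ‖ξ' a - ξ' b‖ ≤ L * |a - b| ^ α := fun a b =>
    (hHolder _ (projIcc 0 T hT' a).2 _ (projIcc 0 T hT' b).2).trans <|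
      mul_le_mul_of_nonneg_left
        (rpow_le_rpow (abs_nonneg _) (abs_projIcc_sub_projIcc hT') hα.le) hL.le
  have hξ'_eq : ∀ t ∈ Ioo (0 : ℝ) T, ξ' t = ξ t := fun t ht => by
    simp only [ξ', projIcc_of_mem hT' (Ioo_subset_Icc_self ht)]
  obtain ⟨M, hM, happrox⟩ := exists_smooth_approx_of_holder (E := EuclideanSpace ℝ (Fin N))
  obtain ⟨F, A, B, hF, hF_one, hF_zero, hF_mem, hA, hB⟩ :=
    exists_smooth_cutoff fun i : Fin N => EuclideanSpace.single i (1 : ℝ)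
  have hA0 : 0 ≤ A := (norm_nonneg _).trans (hA 0)
  have hB0 : 0 ≤ B := (abs_nonneg _).trans (hB 0)
  -- The time scale attached to `r`, chosen so that `ξ'` moves by at most `r / 8` over it.
  let ε : ℝ → ℝ := fun r => (r / (8 * L)) ^ (1 / α)
  have hε : ∀ r, 0 < r → 0 < ε r := fun r hr => by positivity
  have hεα : ∀ r, 0 < r → ε r ^ α = r / (8 * L) := fun r hr => by
    rw [← rpow_mul (by positivity), one_div_mul_cancel hα.ne', rpow_one]
  have hε_inv : ∀ r, 0 < r → (ε r)⁻¹ = (8 * L) ^ (1 / α) * r ^ (-(1 / α)) := fun r hr => by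
    simp only [ε]
    rw [div_rpow hr.le (by positivity), inv_div, rpow_neg hr.le, div_eq_mul_inv]
  have hscaled : ∀ r, 0 < r → ∃ g : ℝ → EuclideanSpace ℝ (Fin N), ContDiff ℝ (⊤ : ℕ∞) g ∧
      ∀ t, ‖g t - r⁻¹ • ξ' (ε r * t)‖ ≤ 1 / 8 ∧ ‖deriv g t‖ ≤ M * (1 / 8) := fun r hr => by
    refine happrox α (1 / 8) _ hα (by norm_num) fun a b => ?_
    rw [← smul_sub, norm_smul, norm_inv, Real.norm_of_nonneg hr.le]
    calc r⁻¹ * ‖ξ' (ε r * a) - ξ' (ε r * b)‖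
        ≤ r⁻¹ * (L * |ε r * a - ε r * b| ^ α) := by gcongr; exact hξ' _ _
      _ = r⁻¹ * (L * (ε r ^ α * |a - b| ^ α)) := by
        rw [← mul_sub, abs_mul, abs_of_pos (hε r hr),
          mul_rpow (hε r hr).le (abs_nonneg _)]
      _ = 1 / 8 * |a - b| ^ α := by
        rw [hεα r hr]
        field_simp
  choose! g hg hg_bound using hscaled
  refine ⟨A + B + A * (M * (1 / 8)) * (8 * L) ^ (1 / α) + 1, by positivity,
    fun r x t => F (r⁻¹ • x - g r ((ε r)⁻¹ * t)), fun r hr => ⟨?_, fun t ht x => ?_⟩⟩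
  · exact hF.comp ((contDiff_fst.const_smul r⁻¹).sub
      ((hg r hr).comp (contDiff_const.mul contDiff_snd)))
  have hA_le : A ≤ A + B + A * (M * (1 / 8)) * (8 * L) ^ (1 / α) + 1 := by
    have : 0 ≤ A * (M * (1 / 8)) * (8 * L) ^ (1 / α) := by positivity
    linarith
  have hB_le : B ≤ A + B + A * (M * (1 / 8)) * (8 * L) ^ (1 / α) + 1 := by
    have : 0 ≤ A * (M * (1 / 8)) * (8 * L) ^ (1 / α) := by positivity
    linarith
  set p := r⁻¹ • x - g r ((ε r)⁻¹ * t) with hp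
  have hclose : ‖p - r⁻¹ • (x - ξ t)‖ ≤ 1 / 8 := by
    have h := (hg_bound r hr ((ε r)⁻¹ * t)).1
    rw [mul_inv_cancel_left₀ (hε r hr).ne', hξ'_eq t ht] at h
    rwa [hp, smul_sub, sub_sub_sub_cancel_left, norm_sub_rev]
  have hnorm : ‖r⁻¹ • (x - ξ t)‖ = ‖x - ξ t‖ / r := by
    rw [norm_smul, norm_inv, Real.norm_of_nonneg hr.le, inv_mul_eq_div]
  refine ⟨fun h => hF_one _ ?_, fun h => hF_zero _ ?_, (hF_mem _).1, (hF_mem _).2, ?_, ?_, ?_⟩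
  · have h1 : 1 < ‖x - ξ t‖ / r := (one_lt_div hr).2 h
    have h2 := norm_sub_norm_le (r⁻¹ • (x - ξ t)) p
    rw [norm_sub_rev (r⁻¹ • (x - ξ t)) p] at h2
    linarith
  · have h1 : ‖x - ξ t‖ / r < 1 / 2 := by
      rw [div_lt_iff₀ hr]
      linarith
    have h2 := norm_sub_norm_le p (r⁻¹ • (x - ξ t))
    linarith
  · have hd : HasFDerivAt (fun y => F (r⁻¹ • y - g r ((ε r)⁻¹ * t))) (r⁻¹ • fderiv ℝ F p) x := by
      have h := (hF.differentiable (by simp) p).hasFDerivAt.comp x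
        (((hasFDerivAt_id x).const_smul r⁻¹).sub_const (g r ((ε r)⁻¹ * t)))
      simpa [Function.comp_def] using h
    rw [hd.fderiv, norm_smul, norm_inv, Real.norm_of_nonneg hr.le, inv_mul_eq_div]
    gcongr
    exact (hA p).trans hA_le
  · have hline : ∀ i : Fin N, iteratedDeriv 2 (fun h : ℝ => F (r⁻¹ •
        (x + h • EuclideanSpace.single i (1 : ℝ)) - g r ((ε r)⁻¹ * t))) 0 = r⁻¹ ^ 2 *
        fderiv ℝ (fun y => fderiv ℝ F y (EuclideanSpace.single i (1 : ℝ))) p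
          (EuclideanSpace.single i (1 : ℝ)) := fun i => by
      rw [← iteratedDeriv_two_comp_line hF]
      congr 1
      funext h
      rw [hp, smul_add, smul_smul, add_sub_right_comm]
    rw [Finset.sum_congr rfl fun i _ => hline i, ← Finset.mul_sum, abs_mul,
      abs_of_nonneg (by positivity), inv_pow, inv_mul_eq_div]
    gcongr
    exact (hB p).trans hB_le
  · have hd : HasDerivAt (fun τ => F (r⁻¹ • x - g r ((ε r)⁻¹ * τ)))
        (fderiv ℝ F p (-((ε r)⁻¹ • deriv (g r) ((ε r)⁻¹ * t)))) t := by
      have h1 := ((hg r hr).differentiable (by simp) ((ε r)⁻¹ * t)).hasDerivAt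
      have h2 := h1.scomp t ((hasDerivAt_id t).const_mul (ε r)⁻¹)
      rw [mul_one] at h2
      exact (hF.differentiable (by simp) p).hasFDerivAt.comp_hasDerivAt t (h2.const_sub _)
    rw [hd.deriv]
    calc |fderiv ℝ F p (-((ε r)⁻¹ • deriv (g r) ((ε r)⁻¹ * t)))|
        ≤ A * ((ε r)⁻¹ * (M * (1 / 8))) := by
          refine ((fderiv ℝ F p).le_of_opNorm_le (hA p) _).trans ?_
          rw [norm_neg, norm_smul, norm_inv, Real.norm_of_nonneg (hε r hr).le]
          have := hε r hr
          gcongr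
          exact (hg_bound r hr _).2
      _ = A * (M * (1 / 8)) * (8 * L) ^ (1 / α) * r ^ (-(1 / α)) := by
          rw [hε_inv r hr]
          ring
      _ ≤ _ := by
          gcongr
          linarith
end
end
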